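/- arXiv:1808.06665 — 14 statements merged into one kernel-verified Lean document; each statement's English description precedes it below -/
import Mathlib

section
/- Let q be an odd prime power and let F be the finite field with q elements. Then every matrix A in Mat₂(F) can be written as a sum of exactly eight orthogonal matrices, i.e. there exist B₁, ..., B₈ ∈ Mat₂(F) with Bᵢᵀ·Bᵢ = I for each i and A = B₁ + ... + B₈. -/
open Matrix

/-- If `-1` has a square root `j`, every `(p, r)` with `r ≠ 0` and `p * r ≠ 1` is the sum of four
points of the hyperbola `a * b = 1`. -/
lemma exists_four_hyperbola_of_ne {F : Type*} [Field F] (h2 : (2 : F) ≠ 0) {j : F}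
    (hj : j * j = -1) {p r : F} (hr : r ≠ 0) (hpr : p * r ≠ 1) :
    ∃ a b : Fin 4 → F, (∀ k, a k * b k = 1) ∧ ∑ k, a k = p ∧ ∑ k, b k = r := by
  obtain ⟨m, hm⟩ : ∃ m, m = p - r⁻¹ := ⟨_, rfl⟩
  have hm0 : m ≠ 0 := by
    intro h
    apply hpr
    rw [sub_eq_zero.1 (hm.symm.trans h), inv_mul_cancel₀ hr]
  refine ⟨![m * (1 - j), m * (1 + j), -m, r⁻¹],
    ![m⁻¹ * ((1 + j) / 2), m⁻¹ * ((1 - j) / 2), -m⁻¹, r], ?_, ?_, ?_⟩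
  · intro k
    fin_cases k
    · simp
      field_simp
      linear_combination -hj
    · simp
      field_simp
      linear_combination -hj
    · simp [hm0]
    · simp [hr]
  · simp [Fin.sum_univ_four]
    linear_combination hm
  · simp [Fin.sum_univ_four]
    field_simp
    ring

/-- The point `(1, 1)` is a sum of four points of the hyperbola `a * b = 1`. -/
lemma exists_four_hyperbola_one {F : Type*} [Field F] (h2 : (2 : F) ≠ 0) :
    ∃ a b : Fin 4 → F, (∀ k, a k * b k = 1) ∧ ∑ k, a k = 1 ∧ ∑ k, b k = 1 := by
  by_cases h3 : (3 : F) = 0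
  · refine ⟨![1, -1, -1, -1], ![1, -1, -1, -1], ?_, ?_, ?_⟩
    · intro k
      fin_cases k <;> simp
    · simp [Fin.sum_univ_four]
      linear_combination -h3
    · simp [Fin.sum_univ_four]
      linear_combination -h3
  by_cases h5 : (5 : F) = 0
  · refine ⟨![-1, -1, -1, -1], ![-1, -1, -1, -1], ?_, ?_, ?_⟩
    · intro k
      fin_cases k <;> simp
    · simp [Fin.sum_univ_four]
      linear_combination -h5
    · simp [Fin.sum_univ_four]
      linear_combination -h5
  have h40 : (40 : F) = 2 * 2 * 2 * 5 := by norm_num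
  have h30 : (30 : F) = 2 * 3 * 5 := by norm_num
  have h8 : (8 : F) = 2 * 2 * 2 := by norm_num
  have h40' : (40 : F) ≠ 0 := by rw [h40]; simp [h2, h5]
  have h30' : (30 : F) ≠ 0 := by rw [h30]; simp [h2, h3, h5]
  have h8' : (8 : F) ≠ 0 := by rw [h8]; simp [h2]
  refine ⟨![-3 / 40, 30 / 40, 8 / 40, 5 / 40], ![-40 / 3, 40 / 30, 40 / 8, 40 / 5], ?_, ?_, ?_⟩
  · intro k
    fin_cases k <;> simp <;> field_simp
  · simp [Fin.sum_univ_four]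
    field_simp
    norm_num
  · simp [Fin.sum_univ_four]
    field_simp
    norm_num

lemma exists_four_hyperbola {F : Type*} [Field F] (h2 : (2 : F) ≠ 0) {j : F}
    (hj : j * j = -1) (p r : F) :
    ∃ a b : Fin 4 → F, (∀ k, a k * b k = 1) ∧ ∑ k, a k = p ∧ ∑ k, b k = r := by
  by_cases hpr : p * r = 1
  · obtain ⟨a, b, hab, ha, hb⟩ := exists_four_hyperbola_one h2
    refine ⟨fun k => p * a k, fun k => r * b k, fun k => ?_, ?_, ?_⟩
    · linear_combination (a k * b k) * hpr + hab k
    · rw [← Finset.mul_sum, ha, mul_one]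
    · rw [← Finset.mul_sum, hb, mul_one]
  by_cases hr : r = 0
  · by_cases hp : p = 0
    · refine ⟨![1, -1, 1, -1], ![1, -1, 1, -1], ?_, ?_, ?_⟩
      · intro k
        fin_cases k <;> simp
      · simp [Fin.sum_univ_four, hp]
      · simp [Fin.sum_univ_four, hr]
    · obtain ⟨a, b, hab, ha, hb⟩ :=
        exists_four_hyperbola_of_ne h2 hj hp (p := r) (by rwa [mul_comm])
      exact ⟨b, a, fun k => by rw [mul_comm, hab k], hb, ha⟩
  · exact exists_four_hyperbola_of_ne h2 hj hr hpr

lemma exists_four_circle_of_sqrt {F : Type*} [Field F] (h2 : (2 : F) ≠ 0) {j : F}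
    (hj : j * j = -1) (x y : F) :
    ∃ a b : Fin 4 → F, (∀ k, a k ^ 2 + b k ^ 2 = 1) ∧ ∑ k, a k = x ∧ ∑ k, b k = y := by
  obtain ⟨a, b, hab, ha, hb⟩ := exists_four_hyperbola h2 hj (x + j * y) (x - j * y)
  refine ⟨fun k => (a k + b k) / 2, fun k => j * (b k - a k) / 2, fun k => ?_, ?_, ?_⟩
  · field_simp
    linear_combination (b k - a k) ^ 2 * hj + 4 * hab k
  · rw [← Finset.sum_div, Finset.sum_add_distrib, ha, hb]
    field_simp
    ring
  · rw [← Finset.sum_div, ← Finset.mul_sum, Finset.sum_sub_distrib, ha, hb]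
    field_simp
    linear_combination -2 * y * hj

lemma eq_zero_of_sq_add_sq {F : Type*} [Field F] (hs : ¬ IsSquare (-1 : F)) {x y : F}
    (h : x ^ 2 + y ^ 2 = 0) : x = 0 ∧ y = 0 := by
  have hy : y = 0 := by
    by_contra hy
    apply hs
    refine ⟨x / y, ?_⟩
    field_simp
    linear_combination -h
  subst hy
  simpa using h

/-- The unit circle over a finite field. -/
def unitCircle (F : Type*) [Field F] [Fintype F] [DecidableEq F] : Finset (F × F) :=
  Finset.univ.filter fun u => u.1 ^ 2 + u.2 ^ 2 = 1

lemma mem_unitCircle {F : Type*} [Field F] [Fintype F] [DecidableEq F] {u : F × F} :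
    u ∈ unitCircle F ↔ u.1 ^ 2 + u.2 ^ 2 = 1 := by
  simp [unitCircle]

/-- Stereographic projection gives at least `q + 1` points on the circle when `-1` is not a
square. -/
lemma card_lt_card_unitCircle {F : Type*} [Field F] [Fintype F] [DecidableEq F]
    (h2 : (2 : F) ≠ 0) (hs : ¬ IsSquare (-1 : F)) :
    Fintype.card F < (unitCircle F).card := by
  have hne (t : F) : 1 + t ^ 2 ≠ 0 := fun h =>
    one_ne_zero (eq_zero_of_sq_add_sq hs (x := 1) (y := t) (by simpa using h)).1
  have hlt : Fintype.card F < Fintype.card (Option F) := by simp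
  refine hlt.trans_le ?_
  refine Finset.card_le_card_of_injOn (s := (Finset.univ : Finset (Option F)))
    (fun o => o.elim (-1, 0) fun t => ((1 - t ^ 2) / (1 + t ^ 2), 2 * t / (1 + t ^ 2))) ?_ ?_
  · rintro (_ | t) -
    · simp [mem_unitCircle]
    · have := hne t
      simp only [Option.elim, Finset.mem_coe, mem_unitCircle]
      field_simp
      ring
  · have key (t : F) : (1 - t ^ 2) / (1 + t ^ 2) ≠ -1 := by
      have := hne t
      intro h
      field_simp at h
      exact h2 (by linear_combination h)
    rintro (_ | s) - (_ | t) - h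
    · rfl
    · exact absurd (congrArg Prod.fst h).symm (key t)
    · exact absurd (congrArg Prod.fst h) (key s)
    · have e1 := congrArg Prod.fst h
      have e2 := congrArg Prod.snd h
      have hs' := hne s
      have ht' := hne t
      simp only [Option.elim] at e1 e2
      have e3 : (1 + s ^ 2)⁻¹ = (1 + t ^ 2)⁻¹ := by
        have a1 : (1 - s ^ 2) / (1 + s ^ 2) = 2 * (1 + s ^ 2)⁻¹ - 1 := by field_simp; ring
        have a2 : (1 - t ^ 2) / (1 + t ^ 2) = 2 * (1 + t ^ 2)⁻¹ - 1 := by field_simp; ring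
        rw [a1, a2] at e1
        exact mul_left_cancel₀ h2 (by linear_combination e1)
      rw [div_eq_mul_inv, div_eq_mul_inv, e3] at e2
      have := mul_left_cancel₀ h2 (mul_right_cancel₀ (inv_ne_zero ht') e2)
      rw [this]

/-- A nonzero vector is a sum of two given unit vectors in at most one way, up to order. -/
lemma eq_or_eq_of_add_eq_add {F : Type*} [Field F] (h2 : (2 : F) ≠ 0)
    (hs : ¬ IsSquare (-1 : F)) {u w u₀ w₀ : F × F}
    (hu : u.1 ^ 2 + u.2 ^ 2 = 1) (hw : w.1 ^ 2 + w.2 ^ 2 = 1)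
    (hu₀ : u₀.1 ^ 2 + u₀.2 ^ 2 = 1) (hw₀ : w₀.1 ^ 2 + w₀.2 ^ 2 = 1)
    (h : u + w = u₀ + w₀) (hne : u₀ + w₀ ≠ 0) : u = u₀ ∨ u = w₀ := by
  obtain ⟨x, y⟩ := u
  obtain ⟨z, t⟩ := w
  obtain ⟨x₀, y₀⟩ := u₀
  obtain ⟨z₀, t₀⟩ := w₀
  simp only [Prod.mk_add_mk, Prod.mk.injEq, ne_eq, Prod.mk_eq_zero] at *
  obtain ⟨ha, hb⟩ := h
  obtain rfl : z = x₀ + z₀ - x := by linear_combination ha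
  obtain rfl : t = y₀ + t₀ - y := by linear_combination hb
  have hav : (x - x₀) * (x₀ + z₀) + (y - y₀) * (y₀ + t₀) = 0 :=
    mul_left_cancel₀ h2 (by linear_combination hu - hw - hu₀ + hw₀)
  have hbv : (x - z₀) * (x₀ + z₀) + (y - t₀) * (y₀ + t₀) = 0 :=
    mul_left_cancel₀ h2 (by linear_combination hu - hw + hu₀ - hw₀)
  have hab : (x - x₀) * (x - z₀) + (y - y₀) * (y - t₀) = 0 :=
    mul_left_cancel₀ h2 (by linear_combination hu + hw - hu₀ - hw₀)
  by_contra! hcon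
  obtain ⟨h1, h3⟩ := hcon
  have hn : (x₀ + z₀) ^ 2 + (y₀ + t₀) ^ 2 ≠ 0 := fun h => hne (eq_zero_of_sq_add_sq hs h)
  have hA : (x - x₀) ^ 2 + (y - y₀) ^ 2 ≠ 0 := fun h => by
    obtain ⟨p, q⟩ := eq_zero_of_sq_add_sq hs h
    exact h1 (sub_eq_zero.1 p) (sub_eq_zero.1 q)
  have hB : (x - z₀) ^ 2 + (y - t₀) ^ 2 ≠ 0 := fun h => by
    obtain ⟨p, q⟩ := eq_zero_of_sq_add_sq hs h
    exact h3 (sub_eq_zero.1 p) (sub_eq_zero.1 q)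
  generalize x - x₀ = a at *
  generalize y - y₀ = b at *
  generalize x - z₀ = c at *
  generalize y - t₀ = d at *
  generalize x₀ + z₀ = p at *
  generalize y₀ + t₀ = q at *
  have hcross : (c * q - d * p) * (a ^ 2 + b ^ 2) = 0 := by
    linear_combination (a * q - b * p) * hab - (a * d - b * c) * hav
  have hc0 := (mul_eq_zero.1 hcross).resolve_right hA
  refine mul_ne_zero hn hB ?_
  linear_combination (c * q - d * p) * hc0 + (c * p + d * q) * hbv

lemma exists_four_circle_of_not_isSquare {F : Type*} [Field F] [Fintype F]
    (h2 : (2 : F) ≠ 0) (hs : ¬ IsSquare (-1 : F)) (x y : F) :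
    ∃ a b : Fin 4 → F, (∀ k, a k ^ 2 + b k ^ 2 = 1) ∧ ∑ k, a k = x ∧ ∑ k, b k = y := by
  classical
  let C := unitCircle F
  let P := (C ×ˢ C).filter fun u => u.1 + u.2 ≠ 0
  let S := P.image fun u => u.1 + u.2
  have hC : Fintype.card F < C.card := card_lt_card_unitCircle h2 hs
  have hanti : ((C ×ˢ C).filter fun u => ¬ u.1 + u.2 ≠ 0).card ≤ C.card := by
    refine Finset.card_le_card_of_injOn Prod.fst ?_ ?_
    · intro u hu
      simp only [Finset.coe_filter, Finset.mem_product, Set.mem_ofPred_eq] at hu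
      exact hu.1.1
    · intro u hu w hw h
      simp only [Finset.coe_filter, Set.mem_ofPred_eq, not_not] at hu hw
      refine Prod.ext h ?_
      rw [← neg_eq_of_add_eq_zero_right hu.2, ← neg_eq_of_add_eq_zero_right hw.2, h]
  have hP : C.card * C.card ≤ P.card + C.card := by
    rw [← Finset.card_product, ← Finset.card_filter_add_card_filter_not (s := C ×ˢ C)
      (fun u => u.1 + u.2 ≠ 0)]
    exact Nat.add_le_add_left hanti _
  have hPS : P.card ≤ 2 * S.card := by
    refine Finset.card_le_mul_card_image P 2 ?_
    intro v hv
    obtain ⟨u₀, hu₀, rfl⟩ := Finset.mem_image.1 hv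
    refine (Finset.card_le_card (t := {u₀, u₀.swap}) ?_).trans Finset.card_le_two
    intro u hu
    simp only [P, C, Finset.mem_filter, Finset.mem_product, mem_unitCircle] at hu hu₀
    rw [Finset.mem_insert, Finset.mem_singleton]
    obtain ⟨⟨⟨h1, h3⟩, -⟩, he⟩ := hu
    refine (eq_or_eq_of_add_eq_add h2 hs h1 h3 hu₀.1.1 hu₀.1.2 he hu₀.2).imp ?_ ?_
    · intro h
      exact Prod.ext h (by rw [h] at he; exact add_left_cancel he)
    · intro h
      exact Prod.ext h (by rw [h, add_comm] at he; exact add_right_cancel he)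
  have hcard : Fintype.card (F × F) < S.card + (S.image fun v => (x, y) - v).card := by
    rw [Finset.card_image_of_injective _ sub_right_injective, Fintype.card_prod]
    nlinarith [Fintype.card_pos (α := F)]
  obtain ⟨v, hv⟩ : (S ∩ S.image fun v => (x, y) - v).Nonempty := by
    rw [← Finset.not_disjoint_iff_nonempty_inter]
    intro hd
    rw [← Finset.card_union_of_disjoint hd] at hcard
    exact (Finset.card_le_univ _).not_gt hcard
  obtain ⟨hv, hv'⟩ := Finset.mem_inter.1 hv
  obtain ⟨w, hw, rfl⟩ := Finset.mem_image.1 hv'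
  obtain ⟨⟨u₁, u₂⟩, hu, hsum⟩ := Finset.mem_image.1 hv
  obtain ⟨⟨u₃, u₄⟩, hu', rfl⟩ := Finset.mem_image.1 hw
  simp only [P, C, Finset.mem_filter, Finset.mem_product, mem_unitCircle] at hu hu'
  refine ⟨![u₁.1, u₂.1, u₃.1, u₄.1], ![u₁.2, u₂.2, u₃.2, u₄.2], ?_, ?_, ?_⟩
  · intro k
    fin_cases k
    exacts [hu.1.1, hu.1.2, hu'.1.1, hu'.1.2]
  · have := congrArg Prod.fst hsum
    simp [Fin.sum_univ_four] at this ⊢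
    linear_combination this
  · have := congrArg Prod.snd hsum
    simp [Fin.sum_univ_four] at this ⊢
    linear_combination this

/-- Over a finite field of odd order, every vector of the plane is a sum of four points of the
unit circle. -/
lemma exists_four_circle {F : Type*} [Field F] [Fintype F] (h2 : (2 : F) ≠ 0) (x y : F) :
    ∃ a b : Fin 4 → F, (∀ k, a k ^ 2 + b k ^ 2 = 1) ∧ ∑ k, a k = x ∧ ∑ k, b k = y := by
  by_cases hs : IsSquare (-1 : F)
  · obtain ⟨j, hj⟩ := hs
    exact exists_four_circle_of_sqrt h2 hj.symm x y
  · exact exists_four_circle_of_not_isSquare h2 hs x y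

/-- Every 2×2 matrix over a finite field of odd order `q` is a sum of
exactly eight orthogonal matrices. -/
theorem sum_of_eight_orthogonal (q : ℕ) (F : Type*) [Field F] [Fintype F]
    (hq : Fintype.card F = q) (hodd : Odd q)
    (A : Matrix (Fin 2) (Fin 2) F) :
    ∃ B : Fin 8 → Matrix (Fin 2) (Fin 2) F,
      (∀ i, (B i)ᵀ * B i = 1) ∧ A = ∑ i, B i := by
  have h2 : (2 : F) ≠ 0 := by
    refine Ring.two_ne_zero fun h => ?_
    have := FiniteField.even_card_iff_char_two.1 h
    rw [hq] at this
    exact absurd (Nat.odd_iff.1 hodd) (by omega)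
  obtain ⟨a, b, hab, ha, hb⟩ := exists_four_circle h2 ((A 0 0 + A 1 1) / 2) ((A 1 0 - A 0 1) / 2)
  obtain ⟨c, d, hcd, hc, hd⟩ := exists_four_circle h2 ((A 0 0 - A 1 1) / 2) ((A 1 0 + A 0 1) / 2)
  refine ⟨Fin.append (m := 4) (n := 4) (fun k => !![a k, -b k; b k, a k])
    (fun k => !![c k, d k; d k, -c k]), fun i => ?_, ?_⟩
  · refine Fin.addCases (m := 4) (n := 4) (fun k => ?_) (fun k => ?_) i
    · rw [Fin.append_left]
      ext r s
      fin_cases r <;> fin_cases s <;> simp [Matrix.mul_apply, Fin.sum_univ_two]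
      · linear_combination hab k
      · ring
      · ring
      · linear_combination hab k
    · rw [Fin.append_right]
      ext r s
      fin_cases r <;> fin_cases s <;> simp [Matrix.mul_apply, Fin.sum_univ_two]
      · linear_combination hcd k
      · ring
      · ring
      · linear_combination hcd k
  · have hsum := Fin.sum_univ_add (a := 4) (b := 4) (Fin.append (fun k => !![a k, -b k; b k, a k])
      (fun k => !![c k, d k; d k, -c k]))
    simp only [Fin.append_left, Fin.append_right] at hsum
    refine Eq.trans ?_ hsum.symm
    ext r s
    rw [Matrix.add_apply, Matrix.sum_apply, Matrix.sum_apply]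
    fin_cases r <;> fin_cases s <;> simp [ha, hb, hc, hd] <;> field_simp <;> ring
end

section
/- Over the field F₅ with 5 elements, the matrix [[1, 0], [1, 0]] ∈ Mat₂(F₅) cannot be written as a sum of seven or fewer orthogonal matrices; that is, for every m ≤ 7 there do not exist matrices B₁, ..., B_m ∈ Mat₂(F₅) with Bᵢᵀ·Bᵢ = I for each i and B₁ + ... + B_m = [[1,0],[1,0]]. -/
open Matrix

/-- The orthogonal `2 × 2` matrices over `𝔽₅` are the signed permutation matrices. -/
theorem orthogonal_entries_zmod_five (a b c d : ZMod 5) (h₁ : a * a + c * c = 1)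
    (h₂ : a * b + c * d = 0) (h₃ : b * b + d * d = 1) :
    ((a = 1 ∨ a = -1) ∧ (d = 1 ∨ d = -1) ∧ b = 0 ∧ c = 0) ∨
      (a = 0 ∧ d = 0 ∧ (b = 1 ∨ b = -1) ∧ (c = 1 ∨ c = -1)) := by
  revert a b c d
  decide

/-- An orthogonal `2 × 2` matrix over `𝔽₅`, encoded by natural numbers: `p` and `q` are the
indicators of being diagonal and antidiagonal, and `x`, `w`, `y`, `z` are the indicators of the
entries equal to `-1`. -/
theorem exists_indicators_of_orthogonal_zmod_five (B : Matrix (Fin 2) (Fin 2) (ZMod 5))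
    (hB : Bᵀ * B = 1) :
    ∃ p q x y z w : ℕ, p + q = 1 ∧ x ≤ p ∧ w ≤ p ∧ y ≤ q ∧ z ≤ q ∧
      B 0 0 = p - 2 * x ∧ B 1 1 = p - 2 * w ∧ B 0 1 = q - 2 * y ∧ B 1 0 = q - 2 * z := by
  have h₁ := congrFun (congrFun hB 0) 0
  have h₂ := congrFun (congrFun hB 0) 1
  have h₃ := congrFun (congrFun hB 1) 1
  simp only [Matrix.mul_apply, Matrix.transpose_apply, Fin.sum_univ_two, Matrix.one_apply_eq,
    Matrix.one_apply_ne (zero_ne_one : (0 : Fin 2) ≠ 1)] at h₁ h₂ h₃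
  have sign : ∀ a : ZMod 5, a = 1 ∨ a = -1 → ∃ x : ℕ, x ≤ 1 ∧ a = 1 - 2 * x := by
    rintro a (rfl | rfl)
    · exact ⟨0, by simp⟩
    · exact ⟨1, le_rfl, by decide⟩
  obtain ⟨ha, hd, hb, hc⟩ | ⟨ha, hd, hb, hc⟩ := orthogonal_entries_zmod_five _ _ _ _ h₁ h₂ h₃
  · obtain ⟨x, hx, hax⟩ := sign _ ha
    obtain ⟨w, hw, hdw⟩ := sign _ hd
    exact ⟨1, 0, x, 0, 0, w, by simp [*]⟩
  · obtain ⟨y, hy, hby⟩ := sign _ hb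
    obtain ⟨z, hz, hcz⟩ := sign _ hc
    exact ⟨0, 1, 0, y, z, 0, by simp [*]⟩

/-- If sums of `k` signs take both the values `0` and `1` modulo `5`, then `k ≥ 4`. -/
theorem four_le_of_sign_sums_zmod_five {k x y : ℕ} (hx : x ≤ k) (hy : y ≤ k)
    (h₁ : (k - 2 * x : ZMod 5) = 1) (h₀ : (k - 2 * y : ZMod 5) = 0) : 4 ≤ k := by
  have h₁' : ((k - 2 * x : ℤ) : ZMod 5) = (1 : ℤ) := by push_cast; exact h₁
  have h₀' : ((k - 2 * y : ℤ) : ZMod 5) = (0 : ℤ) := by push_cast; exact h₀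
  rw [ZMod.intCast_eq_intCast_iff'] at h₁' h₀'
  by_contra! hk
  interval_cases k <;> omega

/-- The matrix `[[1,0],[1,0]]` over `𝔽₅` is not a sum of seven or fewer
orthogonal matrices. -/
theorem not_sum_of_seven_or_fewer_orthogonal :
    ∀ m : ℕ, m ≤ 7 →
      ¬ ∃ B : Fin m → Matrix (Fin 2) (Fin 2) (ZMod 5),
        (∀ i, (B i)ᵀ * B i = 1) ∧
        (∑ i, B i) = !![1, 0; 1, 0] := by
  rintro m hm ⟨B, hB, hsum⟩
  choose p q x y z w hpq hx hw hy hz h₀₀ h₁₁ h₀₁ h₁₀ using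
    fun i => exists_indicators_of_orthogonal_zmod_five (B i) (hB i)
  have entry (r s : Fin 2) (f g : Fin m → ℕ) (h : ∀ i, B i r s = f i - 2 * g i) :
      (((∑ i, f i : ℕ) : ZMod 5) - 2 * ((∑ i, g i : ℕ) : ZMod 5)) =
        (!![1, 0; 1, 0] : Matrix (Fin 2) (Fin 2) (ZMod 5)) r s := by
    rw [← hsum, Matrix.sum_apply, Finset.sum_congr rfl fun i _ => h i]
    push_cast
    rw [Finset.sum_sub_distrib, Finset.mul_sum]
  have hp : 4 ≤ ∑ i, p i := four_le_of_sign_sums_zmod_five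
    (Finset.sum_le_sum fun i _ => hx i) (Finset.sum_le_sum fun i _ => hw i)
    (entry 0 0 p x h₀₀) (entry 1 1 p w h₁₁)
  have hq : 4 ≤ ∑ i, q i := four_le_of_sign_sums_zmod_five
    (Finset.sum_le_sum fun i _ => hz i) (Finset.sum_le_sum fun i _ => hy i)
    (entry 1 0 q z h₁₀) (entry 0 1 q y h₀₁)
  have hm' : ∑ i, p i + ∑ i, q i = m := by
    rw [← Finset.sum_add_distrib, Finset.sum_congr rfl fun i _ => hpq i]
    simp
  omega
end

section
/- Let d ≥ 3 and let q be an odd prime power with F the finite field of order q. If q ≡ 3 (mod 4), then every matrix in Mat_d(F) can be written as a sum of exactly 9·6^(d−2) orthogonal matrices; if q ≡ 1 (mod 4), then every matrix in Mat_d(F) can be written as a sum of exactly 8·6^(d−2) orthogonal matrices. -/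
open Matrix

/-- `A` is a sum of exactly `n` orthogonal matrices. -/
def IsSumOfOrthogonal {ι F : Type*} [Fintype ι] [DecidableEq ι] [CommRing F]
    (n : ℕ) (A : Matrix ι ι F) : Prop :=
  ∃ B : Fin n → Matrix ι ι F, (∀ i, (B i)ᵀ * B i = 1) ∧ A = ∑ i, B i

namespace IsSumOfOrthogonal

section CommRing

variable {ι κ F : Type*} [Fintype ι] [DecidableEq ι] [Fintype κ] [DecidableEq κ] [CommRing F]

theorem zero : IsSumOfOrthogonal 0 (0 : Matrix ι ι F) :=
  ⟨fun _ => 1, by simp, by simp⟩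

theorem add {m n : ℕ} {A B : Matrix ι ι F} (hA : IsSumOfOrthogonal m A)
    (hB : IsSumOfOrthogonal n B) : IsSumOfOrthogonal (m + n) (A + B) := by
  obtain ⟨U, hU, rfl⟩ := hA
  obtain ⟨V, hV, rfl⟩ := hB
  refine ⟨Fin.append U V, fun i => ?_, by simp [Fin.sum_univ_add]⟩
  induction i using Fin.addCases with
  | left i => simpa using hU i
  | right i => simpa using hV i

theorem pair {A B : Matrix ι ι F} (hA : Aᵀ * A = 1) (hB : Bᵀ * B = 1) :
    IsSumOfOrthogonal 2 (A + B) :=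
  ⟨![A, B], by simp [Fin.forall_fin_two, hA, hB], by simp⟩

theorem zero_two_mul (n : ℕ) : IsSumOfOrthogonal (2 * n) (0 : Matrix ι ι F) := by
  induction n with
  | zero => exact zero
  | succ n ih =>
    have h : IsSumOfOrthogonal 2 ((1 : Matrix ι ι F) + -1) := pair (by simp) (by simp)
    simpa [mul_add] using ih.add h

theorem of_two_mul_le {m n : ℕ} {A : Matrix ι ι F} (hA : IsSumOfOrthogonal (2 * m) A)
    (h : m ≤ n) : IsSumOfOrthogonal (2 * n) A := by
  obtain ⟨k, rfl⟩ := Nat.exists_eq_add_of_le h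
  simpa [mul_add] using hA.add (zero_two_mul k)

theorem sum {α : Type*} (s : Finset α) {n : ℕ} {A : α → Matrix ι ι F}
    (hA : ∀ a, IsSumOfOrthogonal n (A a)) : IsSumOfOrthogonal (s.card * n) (∑ a ∈ s, A a) := by
  classical
  induction s using Finset.induction_on with
  | empty => simpa using zero
  | insert a s ha ih =>
    rw [Finset.sum_insert ha, Finset.card_insert_of_notMem ha, add_mul, one_mul, add_comm _ n]
    exact (hA a).add ih

theorem submatrix {n : ℕ} {A : Matrix ι ι F} (hA : IsSumOfOrthogonal n A) (e f : κ ≃ ι) :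
    IsSumOfOrthogonal n (A.submatrix e f) := by
  obtain ⟨U, hU, rfl⟩ := hA
  refine ⟨fun i => (U i).submatrix e f, fun i => ?_, ?_⟩
  · rw [transpose_submatrix, submatrix_mul_equiv, hU, submatrix_one_equiv]
  · ext i j
    simp [Matrix.sum_apply]

theorem fromBlocks_zero {A B : Matrix ι ι F} (hA : Aᵀ * A = 1) (hB : Bᵀ * B = 1) :
    IsSumOfOrthogonal 2 (fromBlocks (A + B) 0 0 (0 : Matrix κ κ F)) := by
  have h : IsSumOfOrthogonal 2 (fromBlocks A 0 0 (1 : Matrix κ κ F) + fromBlocks B 0 0 (-1)) :=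
    pair (by simp [fromBlocks_transpose, fromBlocks_multiply, hA])
      (by simp [fromBlocks_transpose, fromBlocks_multiply, hB])
  simpa [fromBlocks_add] using h

theorem rotation_pair {a b : F} (h : a ^ 2 + b ^ 2 = 1) :
    IsSumOfOrthogonal 2
      (fromBlocks !![2 * a, 0; 0, 2 * a] 0 0 (0 : Matrix κ κ F)) := by
  have key : ∀ b : F, a ^ 2 + b ^ 2 = 1 → !![a, b; -b, a]ᵀ * !![a, b; -b, a] = 1 := by
    intro b hb
    ext i j
    fin_cases i <;> fin_cases j <;> simp [Matrix.mul_apply, Fin.sum_univ_two] <;>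
      first | linear_combination hb | ring
  convert fromBlocks_zero (κ := κ) (key b h) (key (-b) (by simpa using h)) using 2
  ext i j
  fin_cases i <;> fin_cases j <;> simp <;> ring

theorem reflection_pair {a b : F} (h : a ^ 2 + b ^ 2 = 1) :
    IsSumOfOrthogonal 2
      (fromBlocks !![2 * a, 0; 0, -(2 * a)] 0 0 (0 : Matrix κ κ F)) := by
  have key : ∀ b : F, a ^ 2 + b ^ 2 = 1 → !![a, b; b, -a]ᵀ * !![a, b; b, -a] = 1 := by
    intro b hb
    ext i j
    fin_cases i <;> fin_cases j <;> simp [Matrix.mul_apply, Fin.sum_univ_two] <;>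
      first | linear_combination hb | ring
  convert fromBlocks_zero (κ := κ) (key b h) (key (-b) (by simpa using h)) using 2
  ext i j
  fin_cases i <;> fin_cases j <;> simp <;> ring

end CommRing

end IsSumOfOrthogonal

section FiniteField

variable {F : Type*} [Field F] [Fintype F]

theorem two_ne_zero_of_odd_card (hF : Odd (Fintype.card F)) : (2 : F) ≠ 0 := by
  intro h
  have := ringChar.dvd (R := F) (x := 2) (by exact_mod_cast h)
  rcases (Nat.dvd_prime Nat.prime_two).1 this with h1 | h2
  · exact CharP.ringChar_ne_one h1
  · have := FiniteField.even_card_iff_char_two.1 h2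
    have := Nat.odd_iff.1 hF
    omega

/-- Every element of a finite field of odd order is a sum of the abscissas of two points
of the unit circle. -/
theorem exists_add_eq_of_unit_circle (hF : Odd (Fintype.card F)) (c : F) :
    ∃ a b a' b' : F, a ^ 2 + b ^ 2 = 1 ∧ a' ^ 2 + b' ^ 2 = 1 ∧ a + a' = c := by
  classical
  have h2 := two_ne_zero_of_odd_card hF
  let φ : F → F := fun u => -1 + 2 / (1 + u)
  have hφ : Function.Injective φ := by
    intro u v huv
    have h : 2 / (1 + u) = 2 / (1 + v) := add_left_cancel huv
    rw [div_eq_mul_inv, div_eq_mul_inv] at h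
    exact add_left_cancel (inv_injective (mul_left_cancel₀ h2 h))
  have circle : ∀ t : F, φ (t ^ 2) ^ 2 + (2 * t / (1 + t ^ 2)) ^ 2 = 1 := by
    intro t
    by_cases ht : 1 + t ^ 2 = 0
    · simp [φ, ht]
    · simp only [φ]
      field_simp
      ring
  let T : Finset F := Finset.univ.image fun t : F => t ^ 2
  have hT : Fintype.card F < 2 * T.card := by
    have h := FiniteField.card_image_polynomial_eval (R := F) (p := Polynomial.X ^ 2)
      (by simp)
    have h' : Fintype.card F ≤ 2 * T.card := by simpa [T] using h
    have := Nat.odd_iff.1 hF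
    omega
  have hS : (T.image φ).card = T.card := Finset.card_image_of_injective _ hφ
  have hS' : (T.image fun u => c - φ u).card = T.card :=
    Finset.card_image_of_injective _ (sub_right_injective.comp hφ)
  obtain ⟨x, hx⟩ : (T.image φ ∩ T.image fun u => c - φ u).Nonempty := by
    rw [← Finset.card_pos]
    have := Finset.card_union_add_card_inter (T.image φ) (T.image fun u => c - φ u)
    have := Finset.card_le_univ (T.image φ ∪ T.image fun u => c - φ u)
    omega
  simp only [T, Finset.mem_inter, Finset.mem_image, Finset.mem_univ, true_and,
    exists_exists_eq_and] at hx
  obtain ⟨⟨t, rfl⟩, s, hs⟩ := hx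
  exact ⟨_, _, _, _, circle t, circle s, by rw [← hs]; ring⟩

namespace IsSumOfOrthogonal

variable {ι κ : Type*} [Fintype ι] [DecidableEq ι] [Fintype κ] [DecidableEq κ]

theorem fromBlocks_diagonal (hF : Odd (Fintype.card F)) (x y : F) :
    IsSumOfOrthogonal 8 (fromBlocks !![x, 0; 0, y] 0 0 (0 : Matrix κ κ F)) := by
  have h2 := two_ne_zero_of_odd_card hF
  have h4 : (4 : F) ≠ 0 := by
    rw [show (4 : F) = 2 * 2 by norm_num]
    exact mul_ne_zero h2 h2
  obtain ⟨a, b, a', b', h, h', hs⟩ := exists_add_eq_of_unit_circle hF ((x + y) / 4)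
  obtain ⟨c, d, c', d', k, k', ks⟩ := exists_add_eq_of_unit_circle hF ((x - y) / 4)
  rw [eq_div_iff h4] at hs ks
  convert ((rotation_pair (κ := κ) h).add (rotation_pair h')).add
    ((reflection_pair k).add (reflection_pair k')) using 1
  simp only [fromBlocks_add, add_zero]
  congr 1
  ext i j
  fin_cases i <;> fin_cases j <;> simp <;> apply mul_left_cancel₀ h2
  · linear_combination -hs - ks
  · linear_combination ks - hs

theorem exists_equiv_sum {n : ℕ} {i j : Fin (2 + n)} (hij : i ≠ j) :
    ∃ e : Fin (2 + n) ≃ Fin 2 ⊕ Fin n, e i = Sum.inl 0 ∧ e j = Sum.inl 1 := by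
  have hne : (finSumFinEquiv (Sum.inl 0) : Fin (2 + n)) ≠ finSumFinEquiv (Sum.inl 1) :=
    finSumFinEquiv.injective.ne (by simp)
  obtain ⟨σ, hi, hj⟩ := MulAction.is_two_pretransitive_iff.1
    (Equiv.Perm.isMultiplyPretransitive (Fin (2 + n)) 2) hij hne
  rw [Equiv.Perm.smul_def] at hi hj
  exact ⟨σ.trans finSumFinEquiv.symm, by rw [Equiv.trans_apply, hi, Equiv.symm_apply_apply],
    by rw [Equiv.trans_apply, hj, Equiv.symm_apply_apply]⟩

theorem single_add_single (hF : Odd (Fintype.card F)) {d : ℕ} {i i' j j' : Fin d}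
    (hi : i ≠ i') (hj : j ≠ j') (x y : F) :
    IsSumOfOrthogonal 8 (Matrix.single i j x + Matrix.single i' j' y) := by
  obtain ⟨n, rfl⟩ : ∃ n, d = 2 + n := Nat.exists_eq_add_of_le (by omega)
  obtain ⟨e, rfl, rfl⟩ : ∃ e : Fin 2 ⊕ Fin n ≃ Fin (2 + n),
      e (Sum.inl 0) = i ∧ e (Sum.inl 1) = i' := by
    obtain ⟨e, h, h'⟩ := exists_equiv_sum hi
    exact ⟨e.symm, by simp [← h], by simp [← h']⟩
  obtain ⟨f, rfl, rfl⟩ : ∃ e : Fin 2 ⊕ Fin n ≃ Fin (2 + n),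
      e (Sum.inl 0) = j ∧ e (Sum.inl 1) = j' := by
    obtain ⟨e, h, h'⟩ := exists_equiv_sum hj
    exact ⟨e.symm, by simp [← h], by simp [← h']⟩
  convert (fromBlocks_diagonal (κ := Fin n) hF x y).submatrix e.symm f.symm using 1
  ext k l
  obtain ⟨k, rfl⟩ := e.surjective k
  obtain ⟨l, rfl⟩ := f.surjective l
  rcases k with k | k <;> rcases l with l | l
  · fin_cases k <;> fin_cases l <;> simp
  all_goals simp

theorem single (hF : Odd (Fintype.card F)) {d : ℕ} (hd : 2 ≤ d) (i j : Fin d) (x : F) :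
    IsSumOfOrthogonal 8 (Matrix.single i j x) := by
  have : Nontrivial (Fin d) := Fin.nontrivial_iff_two_le.2 hd
  obtain ⟨i', hi⟩ := exists_ne i
  obtain ⟨j', hj⟩ := exists_ne j
  simpa using single_add_single hF hi.symm hj.symm x 0

theorem eight_mul_sq (hF : Odd (Fintype.card F)) {d : ℕ} (hd : 2 ≤ d)
    (A : Matrix (Fin d) (Fin d) F) : IsSumOfOrthogonal (d * (d * 8)) A := by
  rw [matrix_eq_sum_single A]
  simpa using sum Finset.univ fun i => sum Finset.univ fun j => single hF hd i j (A i j)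

theorem fin_three (hF : Odd (Fintype.card F)) (A : Matrix (Fin 3) (Fin 3) F) :
    IsSumOfOrthogonal 48 A := by
  have key : ∀ f : Fin 3 → Fin 3, Function.Injective f →
      IsSumOfOrthogonal 16 (∑ i, Matrix.single i (f i) (A i (f i))) := by
    intro f hf
    rw [Fin.sum_univ_three]
    exact (single_add_single hF (by decide) (hf.ne (by decide)) _ _).add
      (single hF (by norm_num) _ _ _)
  have h : IsSumOfOrthogonal 48 _ :=
    sum Finset.univ fun k : Fin 3 => key (k + ·) (add_right_injective k)
  convert h using 1
  ext i j
  fin_cases i <;> fin_cases j <;> simp [Fin.sum_univ_three]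

theorem eight_mul_six_pow (hF : Odd (Fintype.card F)) {d : ℕ} (hd : 3 ≤ d)
    (A : Matrix (Fin d) (Fin d) F) : IsSumOfOrthogonal (2 * (4 * 6 ^ (d - 2))) A := by
  rcases hd.eq_or_lt with rfl | hd
  · exact fin_three hF A
  have h : ∀ k : ℕ, (k + 4) * (k + 4) ≤ 6 ^ (k + 2) := by
    intro k
    induction k with
    | zero => norm_num
    | succ k ih =>
      rw [show k + 1 + 2 = (k + 2) + 1 by ring, pow_succ]
      nlinarith
  obtain ⟨k, rfl⟩ := Nat.exists_eq_add_of_le' hd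
  have hk := h k
  have hA : IsSumOfOrthogonal (2 * (4 * ((k + 4) * (k + 4)))) A := by
    convert eight_mul_sq hF (by omega) A using 1
    simp only [Nat.succ_eq_add_one]
    ring
  exact hA.of_two_mul_le (Nat.mul_le_mul_left 4 hk)

end IsSumOfOrthogonal

end FiniteField

/-- For `d ≥ 3`, every `d×d` matrix over the finite field of odd order `q` is a sum of
exactly `9·6^(d-2)` orthogonal matrices when `q ≡ 3 (mod 4)` and exactly `8·6^(d-2)`
orthogonal matrices when `q ≡ 1 (mod 4)`. -/
theorem sum_of_orthogonal_dim_ge_three (d q : ℕ) (hd : 3 ≤ d)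
    (F : Type*) [Field F] [Fintype F] (hq : Fintype.card F = q) (hodd : Odd q) :
    (q % 4 = 3 → ∀ A : Matrix (Fin d) (Fin d) F,
      ∃ B : Fin (9 * 6 ^ (d - 2)) → Matrix (Fin d) (Fin d) F,
        (∀ i, (B i)ᵀ * B i = 1) ∧ A = ∑ i, B i) ∧
    (q % 4 = 1 → ∀ A : Matrix (Fin d) (Fin d) F,
      ∃ B : Fin (8 * 6 ^ (d - 2)) → Matrix (Fin d) (Fin d) F,
        (∀ i, (B i)ᵀ * B i = 1) ∧ A = ∑ i, B i) := by
  subst hq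
  refine ⟨fun _ A => ?_, fun _ A => ?_⟩
  · change IsSumOfOrthogonal (9 * 6 ^ (d - 2)) A
    have h6 : 6 ^ (d - 2) = 6 * 6 ^ (d - 3) := by
      rw [← pow_succ']
      congr 1
      omega
    rw [show 9 * 6 ^ (d - 2) = 2 * (27 * 6 ^ (d - 3)) by omega]
    exact (IsSumOfOrthogonal.eight_mul_six_pow hodd hd A).of_two_mul_le (by omega)
  · change IsSumOfOrthogonal (8 * 6 ^ (d - 2)) A
    rw [show 8 * 6 ^ (d - 2) = 2 * (4 * 6 ^ (d - 2)) by ring]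
    exact IsSumOfOrthogonal.eight_mul_six_pow hodd hd A
end

section
/- Let q be an odd prime power and F the finite field of order q. Every vector in F² is the sum of two unit vectors if and only if q = 3. (That is: (∀ v ∈ F², ∃ unit vectors u, w with v = u + w) ↔ q = 3.) -/
/-- Every element of a finite field of odd order is a sum of two squares. -/
theorem exists_sq_add_sq_eq_of_odd_card {F : Type*} [Field F] [Fintype F]
    (hodd : Odd (Fintype.card F)) (c : F) : ∃ a b : F, a ^ 2 + b ^ 2 = c := by
  obtain ⟨a, b, h⟩ := FiniteField.exists_root_sum_quadratic
    (f := Polynomial.X ^ 2) (g := Polynomial.X ^ 2 - Polynomial.C c)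
    (Polynomial.degree_X_pow 2) (Polynomial.degree_X_pow_sub_C two_pos c)
    (Nat.odd_iff.mp hodd)
  refine ⟨a, b, ?_⟩
  simp only [Polynomial.eval_sub, Polynomial.eval_pow, Polynomial.eval_X,
    Polynomial.eval_C] at h
  linear_combination h

theorem two_ne_zero_of_odd_card_s4 {F : Type*} [Field F] [Fintype F]
    (hodd : Odd (Fintype.card F)) : (2 : F) ≠ 0 := by
  intro h
  obtain ⟨k, hk⟩ := hodd
  have h0 : ((Fintype.card F : ℕ) : F) = 0 := FiniteField.cast_card_eq_zero F
  rw [hk] at h0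
  push_cast at h0
  rw [h] at h0
  simp at h0

/-- If a vector `(a, b)` of norm `4 / (1 + x)` is a sum of two unit vectors, then `x` is a
square. -/
theorem isSquare_of_sum_two_units {F : Type*} [Field F] (h2 : (2 : F) ≠ 0) {x a b p r s t : F}
    (hx : (1 + x) * (a ^ 2 + b ^ 2) = 4) (hu : p ^ 2 + r ^ 2 = 1) (hw : s ^ 2 + t ^ 2 = 1)
    (ha : a = p + s) (hb : b = r + t) : IsSquare x := by
  have hN : a ^ 2 + b ^ 2 ≠ 0 := by
    intro h
    rw [h, mul_zero] at hx
    exact mul_ne_zero h2 h2 (by linear_combination -hx)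
  have hdot : 2 * (a * p + b * r) = a ^ 2 + b ^ 2 := by
    subst ha hb
    linear_combination hu - hw
  have hcross : (a * p + b * r) ^ 2 + (a * r - b * p) ^ 2 = a ^ 2 + b ^ 2 := by
    linear_combination (a ^ 2 + b ^ 2) * hu
  refine ⟨2 * (a * r - b * p) / (a ^ 2 + b ^ 2), ?_⟩
  rw [div_mul_div_comm, eq_div_iff (mul_ne_zero hN hN)]
  linear_combination (a ^ 2 + b ^ 2) * hx - 4 * hcross +
    (2 * (a * p + b * r) + (a ^ 2 + b ^ 2)) * hdot

/-- A nonzero isotropic vector is not a sum of two unit vectors. -/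
theorem not_sum_two_units_of_isotropic {F : Type*} [Field F] (h2 : (2 : F) ≠ 0)
    {i p r s t : F} (hi : i ^ 2 = -1) (hu : p ^ 2 + r ^ 2 = 1) (hw : s ^ 2 + t ^ 2 = 1)
    (ha : 1 = p + s) (hb : i = r + t) : False := by
  obtain rfl : s = 1 - p := by linear_combination -ha
  obtain rfl : t = i - r := by linear_combination -hb
  have hdot : p + i * r = 0 := by
    refine (mul_eq_zero.mp ?_).resolve_left h2
    linear_combination hu - hw + hi
  refine one_ne_zero (α := F) ?_
  linear_combination (p - i * r) * hdot - hu + r ^ 2 * hi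

theorem card_eq_three_of_forall_sum_two_units {F : Type*} [Field F] [Fintype F]
    (hodd : Odd (Fintype.card F))
    (h : ∀ v : Fin 2 → F, ∃ u w : Fin 2 → F,
      (∑ i, u i ^ 2) = 1 ∧ (∑ i, w i ^ 2) = 1 ∧ v = u + w) : Fintype.card F = 3 := by
  classical
  have h2 := two_ne_zero_of_odd_card_s4 hodd
  have hneg : ¬ IsSquare (-1 : F) := by
    rintro ⟨i, hi⟩
    obtain ⟨u, w, hu, hw, huw⟩ := h ![1, i]
    rw [Fin.sum_univ_two] at hu hw
    exact not_sum_two_units_of_isotropic (i := i) h2 (by rw [hi, sq]) hu hw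
      (congrFun huw 0) (congrFun huw 1)
  have hsq : ∀ x : F, x ≠ -1 → IsSquare x := by
    intro x hx
    have hx' : 1 + x ≠ 0 := fun h => hx (by linear_combination h)
    obtain ⟨a, b, hab⟩ := exists_sq_add_sq_eq_of_odd_card hodd (4 / (1 + x))
    obtain ⟨u, w, hu, hw, huw⟩ := h ![a, b]
    rw [Fin.sum_univ_two] at hu hw
    exact isSquare_of_sum_two_units (a := a) (b := b) h2
      (by rw [hab, mul_div_cancel₀ _ hx']) hu hw (congrFun huw 0) (congrFun huw 1)
  have huniv : (Finset.univ : Finset F) ⊆ {0, 1, -1} := by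
    intro x _
    simp only [Finset.mem_insert, Finset.mem_singleton]
    by_contra! hx
    obtain ⟨hx0, hx1, hx2⟩ := hx
    have hdiv := (hsq (-x) fun h => hx1 (neg_injective h)).div (hsq x hx2)
    rw [neg_div, div_self hx0] at hdiv
    exact hneg hdiv
  have hle : Fintype.card F ≤ 3 := (Finset.card_le_card huniv).trans Finset.card_le_three
  have hlt : 1 < Fintype.card F := Fintype.one_lt_card
  obtain ⟨k, hk⟩ := hodd
  omega

theorem exists_sum_two_units_of_card_eq_three {F : Type*} [Field F] [Fintype F]
    (hF : Fintype.card F = 3) (v : Fin 2 → F) : ∃ u w : Fin 2 → F,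
      (∑ i, u i ^ 2) = 1 ∧ (∑ i, w i ^ 2) = 1 ∧ v = u + w := by
  have h3 : (3 : F) = 0 := by
    have := FiniteField.cast_card_eq_zero F
    rw [hF] at this
    exact_mod_cast this
  have hsq : ∀ x : F, x ≠ 0 → x ^ 2 = 1 := by
    intro x hx
    have := FiniteField.pow_card_sub_one_eq_one x hx
    rwa [hF] at this
  have hdouble : ∀ x : F, x = -x + -x := fun x => by linear_combination x * h3
  obtain ⟨a, b, rfl⟩ : ∃ a b : F, v = ![a, b] :=
    ⟨v 0, v 1, by ext i; fin_cases i <;> rfl⟩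
  by_cases ha : a = 0 <;> by_cases hb : b = 0
  · exact ⟨![1, 0], ![-1, 0], by simp, by simp, by simp [ha, hb]⟩
  · exact ⟨![0, -b], ![0, -b], by simp [hsq b hb], by simp [hsq b hb],
      by simpa [ha] using hdouble b⟩
  · exact ⟨![-a, 0], ![-a, 0], by simp [hsq a ha], by simp [hsq a ha],
      by simpa [hb] using hdouble a⟩
  · exact ⟨![a, 0], ![0, b], by simp [hsq a ha], by simp [hsq b hb], by simp⟩

/-- Every vector in `F²` is a sum of two unit vectors iff `q = 3`. -/
theorem every_vector_sum_two_units_iff_q_eq_three (q : ℕ) (F : Type*) [Field F] [Fintype F]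
    (hq : Fintype.card F = q) (hodd : Odd q) :
    (∀ v : Fin 2 → F, ∃ u w : Fin 2 → F,
      (∑ i, u i ^ 2) = 1 ∧ (∑ i, w i ^ 2) = 1 ∧ v = u + w) ↔ q = 3 := by
  subst hq
  exact ⟨card_eq_three_of_forall_sum_two_units hodd, exists_sum_two_units_of_card_eq_three⟩
end

section
/- Let q be an odd prime power and F the finite field of order q. Then every vector in F² is the sum of four unit vectors: for every v ∈ F² there exist u₁, u₂, u₃, u₄ ∈ F² with ‖uᵢ‖ = 1 for each i and v = u₁ + u₂ + u₃ + u₄. -/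
section UnitVectorSums

variable {F : Type*} [Field F]

lemma four_ne_zero_of_two_ne_zero (h2 : (2 : F) ≠ 0) : (4 : F) ≠ 0 := by
  rw [show (4 : F) = 2 * 2 by norm_num]
  exact mul_ne_zero h2 h2

/-- `(x, y)` is a sum of two points of the hyperbola `s * t = 1`. -/
def IsHyperbolaPairSum (x y : F) : Prop :=
  ∃ s t : F, s ≠ 0 ∧ t ≠ 0 ∧ s + t = x ∧ s⁻¹ + t⁻¹ = y

lemma isHyperbolaPairSum_zero : IsHyperbolaPairSum (0 : F) 0 :=
  ⟨1, -1, one_ne_zero, neg_ne_zero.2 one_ne_zero, by ring, by simp [inv_neg]⟩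

lemma IsHyperbolaPairSum.of_mul_one_sub_sq (h2 : (2 : F) ≠ 0) {x y c : F}
    (h : x * y * (1 - c ^ 2) = 4) : IsHyperbolaPairSum x y := by
  have h4 := four_ne_zero_of_two_ne_zero h2
  have hx : x ≠ 0 := by rintro rfl; apply h4; rw [← h]; ring
  have hp : 1 + c ≠ 0 := by
    intro h0; apply h4; rw [← h]; linear_combination x * y * (1 - c) * h0
  have hm : 1 - c ≠ 0 := by
    intro h0; apply h4; rw [← h]; linear_combination x * y * (1 + c) * h0
  refine ⟨x * (1 + c) / 2, x * (1 - c) / 2, div_ne_zero (mul_ne_zero hx hp) h2,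
    div_ne_zero (mul_ne_zero hx hm) h2, ?_, ?_⟩
  · field_simp; ring
  · field_simp
    linear_combination -h

/-- If `-1` is not a square, a chord of the circle is determined by its nonzero direction vector
up to the central symmetry. -/
lemma circle_sub_eq_sub (h2 : (2 : F) ≠ 0) (hi : ∀ i : F, i ^ 2 ≠ -1) {p r s t : F × F}
    (hp : p.1 ^ 2 + p.2 ^ 2 = 1) (hr : r.1 ^ 2 + r.2 ^ 2 = 1) (hs : s.1 ^ 2 + s.2 ^ 2 = 1)
    (ht : t.1 ^ 2 + t.2 ^ 2 = 1) (hpr : p ≠ r) (h : p - r = s - t) :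
    s = p ∨ s = -r := by
  obtain ⟨p₁, p₂⟩ := p
  obtain ⟨r₁, r₂⟩ := r
  obtain ⟨s₁, s₂⟩ := s
  obtain ⟨t₁, t₂⟩ := t
  simp only [Prod.mk_sub_mk, Prod.neg_mk, Prod.mk.injEq, ne_eq] at *
  obtain ⟨h₁, h₃⟩ := h
  obtain ⟨x, hx⟩ : ∃ x, x = p₁ - r₁ := ⟨_, rfl⟩
  obtain ⟨y, hy⟩ : ∃ y, y = p₂ - r₂ := ⟨_, rfl⟩
  obtain rfl : r₁ = p₁ - x := by rw [hx]; ring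
  obtain rfl : r₂ = p₂ - y := by rw [hy]; ring
  obtain rfl : t₁ = s₁ - x := by linear_combination h₁
  obtain rfl : t₂ = s₂ - y := by linear_combination h₃
  have hN : x ^ 2 + y ^ 2 ≠ 0 := by
    intro h0
    by_cases hx0 : x = 0
    · have hy0 : y = 0 := by simpa [hx0] using h0
      exact hpr (by simp [hx0, hy0])
    · apply hi (y / x)
      rw [div_pow, div_eq_iff (pow_ne_zero 2 hx0)]
      linear_combination h0
  have eq_zero : ∀ a b : F, x * a + y * b = 0 → x * b - y * a = 0 → a = 0 ∧ b = 0 := by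
    intro a b hin hdet
    constructor
    · apply (mul_eq_zero.1 (_ : (x ^ 2 + y ^ 2) * a = 0)).resolve_left hN
      linear_combination x * hin - y * hdet
    · apply (mul_eq_zero.1 (_ : (x ^ 2 + y ^ 2) * b = 0)).resolve_left hN
      linear_combination y * hin + x * hdet
  have hwd : x * (s₁ - p₁) + y * (s₂ - p₂) = 0 := by
    apply mul_left_cancel₀ h2
    linear_combination hs - ht - hp + hr
  have hwe : x * (s₁ + p₁ - x) + y * (s₂ + p₂ - y) = 0 := by
    apply mul_left_cancel₀ h2
    linear_combination hs - ht + hp - hr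
  have hdet : (x * (s₂ - p₂) - y * (s₁ - p₁)) * (x * (s₂ + p₂ - y) - y * (s₁ + p₁ - x)) = 0 := by
    linear_combination (x ^ 2 + y ^ 2) * (hs - hp - hwd) -
      (x * (s₁ + p₁ - x) + y * (s₂ + p₂ - y)) * hwd
  rcases mul_eq_zero.1 hdet with h0 | h0
  · obtain ⟨h5, h6⟩ := eq_zero _ _ hwd h0
    exact Or.inl ⟨sub_eq_zero.1 h5, sub_eq_zero.1 h6⟩
  · obtain ⟨h5, h6⟩ := eq_zero _ _ hwe h0
    exact Or.inr ⟨by linear_combination h5, by linear_combination h6⟩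

variable [Fintype F]

lemma card_add_one_le_two_mul_card_squares [DecidableEq F] (hodd : Odd (Fintype.card F)) :
    Fintype.card F + 1 ≤ 2 * (Finset.univ.image fun c : F => c ^ 2).card := by
  have h := FiniteField.card_image_polynomial_eval (R := F) (p := Polynomial.X ^ 2) (by simp)
  simp only [Polynomial.natDegree_X_pow, Polynomial.eval_pow, Polynomial.eval_X] at h
  obtain ⟨k, hk⟩ := hodd
  omega

/-- For `x ≠ 0, a` with `x * b` outside `{4 / (1 - c ^ 2)}`, the vertical line through `x`
contains a point splitting `(a, b)` into two sums of two hyperbola points. -/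
lemma exists_split_of_column (hodd : Odd (Fintype.card F)) (h2 : (2 : F) ≠ 0) {a b x : F}
    (ha : a ≠ 0) (hb : b ≠ 0) (hx : x ≠ 0) (hxa : a - x ≠ 0)
    (hG : ∀ c : F, x * b * (1 - c ^ 2) ≠ 4) :
    ∃ y, IsHyperbolaPairSum x y ∧ IsHyperbolaPairSum (a - x) (b - y) := by
  classical
  have h4 := four_ne_zero_of_two_ne_zero h2
  by_contra! hcon
  set y₀ := b * (a - x) / a with hy₀
  have hy : x * y₀ = (a - x) * (b - y₀) := by rw [hy₀]; field_simp; ring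
  have hy₀b : b ≠ y₀ := by
    intro h
    have : b * x = 0 := by
      have h' : b * a = b * (a - x) := by nth_rw 1 [h, hy₀]; field_simp
      linear_combination h'
    exact mul_ne_zero hb hx this
  have hy₀G : ∀ c : F, x * y₀ * (1 - c ^ 2) ≠ 4 := fun c hc =>
    hcon y₀ (.of_mul_one_sub_sq h2 hc) (.of_mul_one_sub_sq h2 (hy ▸ hc))
  set S : Finset F := (Finset.univ.image fun c : F => c ^ 2).erase 1 with hS
  have hScard : Fintype.card F ≤ 2 * S.card + 1 := by
    have := card_add_one_le_two_mul_card_squares (F := F) hodd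
    have := Finset.card_erase_add_one (s := Finset.univ.image fun c : F => c ^ 2) (a := 1)
      (Finset.mem_image.2 ⟨1, Finset.mem_univ _, one_pow 2⟩)
    rw [hS]
    omega
  have hSmem : ∀ e ∈ S, 1 - e ≠ 0 ∧ ∃ c, c ^ 2 = e := by
    intro e he
    rw [hS, Finset.mem_erase, Finset.mem_image] at he
    obtain ⟨he1, c, -, hc⟩ := he
    exact ⟨sub_ne_zero.2 (Ne.symm he1), c, hc⟩
  have hinj : ∀ e ∈ S, ∀ e' ∈ S, ∀ r : F, r ≠ 0 →
      4 / (r * (1 - e)) = 4 / (r * (1 - e')) → e = e' := by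
    intro e he e' he' r hr h
    have h1 := (hSmem e he).1
    have h1' := (hSmem e' he').1
    rw [div_eq_div_iff (mul_ne_zero hr h1) (mul_ne_zero hr h1')] at h
    have h3 := mul_left_cancel₀ hr (mul_left_cancel₀ h4 h)
    linear_combination h3
  set A := S.image fun e => 4 / (x * (1 - e)) with hA
  set B := S.image fun e => b - 4 / ((a - x) * (1 - e)) with hB
  have hAmem : ∀ y ∈ A, ∃ c : F, x * y * (1 - c ^ 2) = 4 := by
    intro y hy
    obtain ⟨e, he, rfl⟩ := Finset.mem_image.1 hy
    obtain ⟨h1, c, rfl⟩ := hSmem e he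
    exact ⟨c, by field_simp⟩
  have hBmem : ∀ y ∈ B, ∃ c : F, (a - x) * (b - y) * (1 - c ^ 2) = 4 := by
    intro y hy
    obtain ⟨e, he, rfl⟩ := Finset.mem_image.1 hy
    obtain ⟨h1, c, rfl⟩ := hSmem e he
    exact ⟨c, by rw [sub_sub_cancel]; field_simp⟩
  have hAcard : A.card = S.card := Finset.card_image_of_injOn fun e he e' he' h =>
    hinj e he e' he' x hx h
  have hBcard : B.card = S.card := Finset.card_image_of_injOn fun e he e' he' h =>
    hinj e he e' he' (a - x) hxa (sub_right_injective h)
  set T : Finset F := Finset.univ \ {b, y₀} with hT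
  have hTcard : T.card + 2 = Fintype.card F := by
    have := Finset.card_sdiff_add_card_eq_card (Finset.subset_univ ({b, y₀} : Finset F))
    rwa [Finset.card_pair hy₀b, Finset.card_univ] at this
  have hAT : A ⊆ T := by
    intro y hyA
    obtain ⟨c, hc⟩ := hAmem y hyA
    simp only [hT, Finset.mem_sdiff, Finset.mem_univ, true_and, Finset.mem_insert,
      Finset.mem_singleton, not_or]
    exact ⟨fun h => hG c (h ▸ hc), fun h => hy₀G c (h ▸ hc)⟩
  have hBT : B ⊆ T := by
    intro y hyB
    obtain ⟨c, hc⟩ := hBmem y hyB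
    simp only [hT, Finset.mem_sdiff, Finset.mem_univ, true_and, Finset.mem_insert,
      Finset.mem_singleton, not_or]
    refine ⟨fun h => h4 ?_, fun h => hy₀G c ?_⟩
    · rw [← hc, h]; ring
    · rw [hy, ← h, hc]
  obtain ⟨y, hyAB⟩ := Finset.inter_nonempty_of_card_lt_card_add_card hAT hBT (by omega)
  obtain ⟨c, hc⟩ := hAmem y (Finset.mem_inter.1 hyAB).1
  obtain ⟨d, hd⟩ := hBmem y (Finset.mem_inter.1 hyAB).2
  exact hcon y (.of_mul_one_sub_sq h2 hc) (.of_mul_one_sub_sq h2 hd)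

lemma exists_hyperbola_split (hodd : Odd (Fintype.card F)) (h2 : (2 : F) ≠ 0) {i : F}
    (hi : i ^ 2 = -1) (a b : F) :
    ∃ x y, IsHyperbolaPairSum x y ∧ IsHyperbolaPairSum (a - x) (b - y) := by
  by_cases ha : a = 0
  · by_cases hb : b = 0
    · subst ha hb
      exact ⟨0, 0, isHyperbolaPairSum_zero, by simpa using isHyperbolaPairSum_zero⟩
    · refine ⟨2 / b, 2 * b, .of_mul_one_sub_sq (c := 0) h2 ?_,
        .of_mul_one_sub_sq (c := i) h2 ?_⟩
      · field_simp; ring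
      · rw [hi, ha]; field_simp; ring
  by_cases hb : b = 0
  · refine ⟨2 * a, 2 / a, .of_mul_one_sub_sq (c := 0) h2 ?_,
      .of_mul_one_sub_sq (c := i) h2 ?_⟩
    · field_simp; ring
    · rw [hi, hb]; field_simp; ring
  have h4 := four_ne_zero_of_two_ne_zero h2
  suffices h : ∃ g : F, ¬ IsSquare g ∧ a * b * (1 - g) ≠ 4 by
    obtain ⟨g, hg, hgab⟩ := h
    have hg1 : 1 - g ≠ 0 := by
      intro h; exact hg ⟨1, by linear_combination -h⟩
    refine ⟨4 / ((1 - g) * b), exists_split_of_column hodd h2 ha hb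
      (div_ne_zero h4 (mul_ne_zero hg1 hb)) ?_ ?_⟩
    · intro h
      apply hgab
      rw [sub_eq_zero.1 h]; field_simp
    · intro c hc
      apply hg
      have : 4 * (1 - c ^ 2) = 4 * (1 - g) := by
        field_simp at hc
        linear_combination 4 * hc
      exact ⟨c, by linear_combination mul_left_cancel₀ h4 this⟩
  obtain ⟨g, hg⟩ := FiniteField.exists_nonsquare (F := F)
    (fun h => h2 (by have := CharP.cast_eq_zero F (ringChar F); rw [h] at this; exact_mod_cast this))
  by_cases hgab : a * b * (1 - g) = 4
  · refine ⟨g⁻¹, fun h => hg (by simpa using h.inv), fun h => ?_⟩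
    have hg0 : g ≠ 0 := by rintro rfl; exact hg ⟨0, by simp⟩
    have h1 : g = g⁻¹ := by
      have := mul_left_cancel₀ (mul_ne_zero ha hb) (hgab.trans h.symm)
      linear_combination -this
    have h3 : (g - 1) * (g + 1) = 0 := by
      have : g * g = 1 := by nth_rw 2 [h1]; exact mul_inv_cancel₀ hg0
      linear_combination this
    rcases mul_eq_zero.1 h3 with h | h
    · exact hg ⟨1, by linear_combination h⟩
    · exact hg ⟨i, by linear_combination h - hi⟩
  · exact ⟨g, hg, hgab⟩

/-- If `-1` is not a square, the circle `x ^ 2 + y ^ 2 = 1` has at least `q + 1` points. -/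
lemma card_add_one_le_card_circle [DecidableEq F] (h2 : (2 : F) ≠ 0)
    (hi : ∀ i : F, i ^ 2 ≠ -1) :
    Fintype.card F + 1 ≤
      (Finset.univ.filter fun p : F × F => p.1 ^ 2 + p.2 ^ 2 = 1).card := by
  have hne : ∀ t : F, 1 + t ^ 2 ≠ 0 := fun t h => hi t (by linear_combination h)
  have hinj : Function.Injective
      fun t : F => ((2 / (1 + t ^ 2) - 1, t * (2 / (1 + t ^ 2))) : F × F) := by
    intro t s h
    simp only [Prod.mk.injEq] at h
    obtain ⟨h₁, h₃⟩ := h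
    rw [sub_left_inj] at h₁
    rw [h₁] at h₃
    exact mul_right_cancel₀ (div_ne_zero h2 (hne s)) h₃
  have hnot : ((-1, 0) : F × F) ∉ Finset.univ.image
      fun t : F => ((2 / (1 + t ^ 2) - 1, t * (2 / (1 + t ^ 2))) : F × F) := by
    intro h
    obtain ⟨t, -, ht⟩ := Finset.mem_image.1 h
    exact div_ne_zero h2 (hne t) (by linear_combination congrArg Prod.fst ht)
  rw [← Finset.card_univ, ← Finset.card_image_of_injective _ hinj,
    ← Finset.card_insert_of_notMem hnot]
  apply Finset.card_le_card
  intro p hp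
  rw [Finset.mem_filter]
  refine ⟨Finset.mem_univ _, ?_⟩
  rcases Finset.mem_insert.1 hp with rfl | hp
  · ring
  · obtain ⟨t, -, rfl⟩ := Finset.mem_image.1 hp
    have := hne t
    field_simp
    ring

lemma exists_circle_split (hi : ∀ i : F, i ^ 2 ≠ -1) (h2 : (2 : F) ≠ 0) (v : F × F) :
    ∃ p r s t : F × F, p.1 ^ 2 + p.2 ^ 2 = 1 ∧ r.1 ^ 2 + r.2 ^ 2 = 1 ∧
      s.1 ^ 2 + s.2 ^ 2 = 1 ∧ t.1 ^ 2 + t.2 ^ 2 = 1 ∧ v = (p - r) + (s - t) := by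
  classical
  set C := Finset.univ.filter fun p : F × F => p.1 ^ 2 + p.2 ^ 2 = 1 with hC
  have hCcard : Fintype.card F + 1 ≤ C.card := card_add_one_le_card_circle h2 hi
  have hmem : ∀ p, p ∈ C ↔ p.1 ^ 2 + p.2 ^ 2 = 1 := fun p => by simp [hC]
  set T := C.offDiag.image fun z => z.1 - z.2 with hT
  have hTcard : C.offDiag.card ≤ 2 * T.card := by
    refine Finset.card_le_mul_card_image C.offDiag 2 fun w hw => ?_
    obtain ⟨⟨p, r⟩, hz, rfl⟩ := Finset.mem_image.1 hw
    rw [Finset.mem_offDiag, hmem, hmem] at hz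
    refine (Finset.card_le_card (t := {(p, r), (-r, -p)}) ?_).trans Finset.card_le_two
    rintro ⟨s, t⟩ hst
    rw [Finset.mem_filter, Finset.mem_offDiag, hmem, hmem] at hst
    obtain ⟨⟨hs, ht, -⟩, hst⟩ := hst
    have ht' : t = s - (p - r) := by rw [← hst]; simp
    rw [Finset.mem_insert, Finset.mem_singleton]
    rcases circle_sub_eq_sub h2 hi hz.1 hz.2.1 hs ht hz.2.2 hst.symm with h | h
    · left; dsimp only at h; subst h ht'; simp
    · right; dsimp only at h; subst h ht'; congr 1; abel
  have hV : (T.image fun w => v - w).card = T.card :=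
    Finset.card_image_of_injective _ sub_right_injective
  have hlt : (Finset.univ : Finset (F × F)).card < T.card + (T.image fun w => v - w).card := by
    rw [hV, Finset.card_univ, Fintype.card_prod]
    rw [Finset.offDiag_card] at hTcard
    have hpos : 0 < Fintype.card F := Fintype.card_pos
    obtain ⟨k, hk⟩ := Nat.exists_eq_add_of_le hCcard
    have : C.card * C.card - C.card = C.card * (Fintype.card F + k) := by
      rw [← Nat.mul_sub_one, hk]; congr 1; omega
    rw [this, hk] at hTcard
    nlinarith
  obtain ⟨w, hw⟩ := Finset.inter_nonempty_of_card_lt_card_add_card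
    (Finset.subset_univ _) (Finset.subset_univ _) hlt
  rw [Finset.mem_inter, Finset.mem_image, Finset.mem_image] at hw
  obtain ⟨⟨⟨p, r⟩, hz, rfl⟩, w', hw', hww'⟩ := hw
  obtain ⟨⟨s, t⟩, hz', rfl⟩ := Finset.mem_image.1 hw'
  rw [Finset.mem_offDiag, hmem, hmem] at hz hz'
  exact ⟨p, r, s, t, hz.1, hz.2.1, hz'.1, hz'.2.1, by rw [← hww']; abel⟩

end UnitVectorSums

/-- Every vector in `F²` is the sum of four unit vectors. -/
theorem every_vector_sum_four_units (q : ℕ) (F : Type*) [Field F] [Fintype F]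
    (hq : Fintype.card F = q) (hodd : Odd q) (v : Fin 2 → F) :
    ∃ u : Fin 4 → (Fin 2 → F),
      (∀ i, (∑ j, u i j ^ 2) = 1) ∧ v = ∑ i, u i := by
  subst hq
  have hchar : ringChar F ≠ 2 := fun h => by
    have := FiniteField.even_card_of_char_two h
    have := Nat.odd_iff.1 hodd
    omega
  have h2 : (2 : F) ≠ 0 := Ring.two_ne_zero hchar
  by_cases hi : ∃ i : F, i ^ 2 = -1
  · obtain ⟨i, hi⟩ := hi
    have hi0 : i ≠ 0 := by rintro rfl; simp at hi
    obtain ⟨x, y, ⟨s, t, hs, ht, hx, hy⟩, s', t', hs', ht', hx', hy'⟩ :=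
      exists_hyperbola_split hodd h2 hi (v 0 + i * v 1) (v 0 - i * v 1)
    have hunit : ∀ r : F, r ≠ 0 →
        ∑ j, (![(r + r⁻¹) / 2, (r - r⁻¹) / (2 * i)] : Fin 2 → F) j ^ 2 = 1 := by
      intro r hr
      simp only [Fin.sum_univ_two, Matrix.cons_val_zero, Matrix.cons_val_one]
      rw [div_pow, div_pow, mul_pow, hi]
      field_simp
      ring
    refine ⟨fun k => (fun r : F => ![(r + r⁻¹) / 2, (r - r⁻¹) / (2 * i)]) (![s, t, s', t'] k),
      fun k => hunit _ ?_, ?_⟩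
    · fin_cases k <;> assumption
    · ext j
      rw [Finset.sum_apply, Fin.sum_univ_four]
      fin_cases j
      · simp
        rw [← add_div, ← add_div, ← add_div, eq_div_iff h2]
        linear_combination -hx - hy - hx' - hy'
      · simp
        rw [← add_div, ← add_div, ← add_div, eq_div_iff (mul_ne_zero h2 hi0)]
        linear_combination -hx + hy - hx' + hy'
  · push Not at hi
    obtain ⟨p, r, s, t, hp, hr, hs, ht, h⟩ := exists_circle_split hi h2 (v 0, v 1)
    refine ⟨![![p.1, p.2], ![-r.1, -r.2], ![s.1, s.2], ![-t.1, -t.2]], fun k => ?_, ?_⟩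
    · fin_cases k <;> simpa [Fin.sum_univ_two]
    · have h₁ := congrArg Prod.fst h
      have h₃ := congrArg Prod.snd h
      simp only [Prod.fst_add, Prod.snd_add, Prod.fst_sub, Prod.snd_sub] at h₁ h₃
      ext j
      rw [Finset.sum_apply, Fin.sum_univ_four]
      fin_cases j
      · simp [h₁]; ring
      · simp [h₃]; ring
end

section
/- Let q be an odd prime power with q ≡ 3 (mod 4) and F the finite field of order q. Then every nonzero vector in F² is the sum of three unit vectors: for every v ∈ F² with v ≠ 0 there exist u₁, u₂, u₃ ∈ F² with ‖uᵢ‖ = 1 for each i and v = u₁ + u₂ + u₃. -/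
/-- Over a finite field of odd order in which `-1` is not a square, `c - x ^ 2` is a square for at
least half of all `x`, if `c ≠ 0`. -/
lemma card_le_two_mul_card_isSquare_sub_sq {F : Type*} [Field F] [Fintype F]
    [DecidablePred fun x : F => IsSquare x]
    (h2 : (2 : F) ≠ 0) (hneg : ¬ IsSquare (-1 : F)) {c : F} (hc : c ≠ 0) :
    Fintype.card F ≤ 2 * (Finset.univ.filter fun x : F => IsSquare (c - x ^ 2)).card := by
  classical
  have hodd : Fintype.card F % 2 = 1 := FiniteField.odd_card_of_char_ne_two fun h => h2 <| by
    have := ringChar.charP F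
    rw [h] at this
    exact_mod_cast CharP.cast_eq_zero F 2
  obtain ⟨a, b, hab⟩ : ∃ a b : F, a ^ 2 + b ^ 2 = c := by
    obtain ⟨a, b, h⟩ := FiniteField.exists_root_sum_quadratic
      (Polynomial.degree_X_pow (R := F) 2) (Polynomial.degree_X_pow_sub_C two_pos c) hodd
    refine ⟨a, b, ?_⟩
    simp only [Polynomial.eval_sub, Polynomial.eval_pow, Polynomial.eval_X,
      Polynomial.eval_C] at h
    linear_combination h
  have hr (r : F) : 1 + r ^ 2 ≠ 0 := fun h => hneg ⟨r, by linear_combination -h⟩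
  rw [← Finset.card_univ]
  refine Finset.card_le_mul_card_image_of_maps_to
    (f := fun r : F => (a * (1 - r ^ 2) - 2 * r * b) / (1 + r ^ 2)) ?_ 2 ?_
  · intro r _
    simp only [Finset.mem_filter, Finset.mem_univ, true_and]
    refine ⟨(b * (1 - r ^ 2) + 2 * r * a) / (1 + r ^ 2), ?_⟩
    have := hr r
    field_simp
    linear_combination (-(1 + r ^ 2) ^ 2) * hab
  · intro x _
    set p : Polynomial F := Polynomial.C (x + a) * Polynomial.X ^ 2 +
      Polynomial.C (2 * b) * Polynomial.X + Polynomial.C (x - a) with hp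
    have hp0 : p ≠ 0 := by
      intro h
      have e0 : x - a = 0 := by
        simpa [hp] using congrArg (Polynomial.eval 0) h
      have e1 : 2 * b = 0 := by
        have := congrArg (Polynomial.eval 1) h
        have h' := congrArg (Polynomial.eval (-1)) h
        simp [hp] at this h'
        have : 2 * (2 * b) = 0 := by linear_combination this - h'
        simpa [h2] using this
      have e2 : x + a = 0 := by
        have := congrArg (Polynomial.eval 1) h
        simp [hp] at this
        linear_combination this - e1 - e0
      have hb : b = 0 := by simpa [h2] using e1
      have ha : a = 0 := by
        have : 2 * a = 0 := by linear_combination e2 - e0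
        simpa [h2] using this
      exact hc (by rw [← hab, ha, hb]; ring)
    calc _ ≤ p.roots.toFinset.card := by
          refine Finset.card_le_card fun r hx => ?_
          simp only [Finset.mem_filter, Finset.mem_univ, true_and] at hx
          rw [div_eq_iff (hr r)] at hx
          rw [Multiset.mem_toFinset, Polynomial.mem_roots hp0, Polynomial.IsRoot.def]
          simp only [hp, Polynomial.eval_add, Polynomial.eval_mul, Polynomial.eval_C,
            Polynomial.eval_pow, Polynomial.eval_X]
          linear_combination -hx
      _ ≤ p.roots.card := Multiset.toFinset_card_le _
      _ ≤ p.natDegree := p.card_roots'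
      _ ≤ 2 := Polynomial.natDegree_quadratic_le

/-- If `q ≡ 3 (mod 4)`, every nonzero vector in `F²` is the sum of three unit vectors. -/
theorem nonzero_vector_sum_three_units (q : ℕ) (F : Type*) [Field F] [Fintype F]
    (hq : Fintype.card F = q) (hodd : Odd q) (hq4 : q % 4 = 3)
    (v : Fin 2 → F) (hv : v ≠ 0) :
    ∃ u : Fin 3 → (Fin 2 → F),
      (∀ i, (∑ j, u i j ^ 2) = 1) ∧ v = ∑ i, u i := by
  classical
  have hneg : ¬ IsSquare (-1 : F) := by
    rw [FiniteField.isSquare_neg_one_iff, hq]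
    exact not_not.2 hq4
  have h2 : (2 : F) ≠ 0 := Ring.two_ne_zero fun h => by
    have := FiniteField.even_card_of_char_two h
    omega
  have anisotropic (x y : F) (h : x ^ 2 + y ^ 2 = 0) : x = 0 ∧ y = 0 := by
    have hy : y = 0 := by
      by_contra hy
      refine hneg ⟨x / y, ?_⟩
      field_simp
      linear_combination -h
    subst hy
    simpa using h
  obtain ⟨a, ha⟩ : ∃ a, a = v 0 := ⟨_, rfl⟩
  obtain ⟨b, hb⟩ : ∃ b, b = v 1 := ⟨_, rfl⟩
  have hN : a ^ 2 + b ^ 2 ≠ 0 := by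
    intro h
    obtain ⟨h0, h1⟩ := anisotropic a b h
    refine hv (funext fun i => ?_)
    fin_cases i
    · simpa [h0] using ha.symm
    · simpa [h1] using hb.symm
  obtain ⟨N, hNdef⟩ : ∃ N, N = a ^ 2 + b ^ 2 := ⟨_, rfl⟩
  rw [← hNdef] at hN
  obtain ⟨s, ⟨t, ht⟩, w, hw⟩ :
      ∃ s : F, IsSquare (N - s ^ 2) ∧ IsSquare (4 - (N - 1 - 2 * s) ^ 2) := by
    have h4 : (4 : F) ≠ 0 := by
      rw [show (4 : F) = 2 * 2 by norm_num]
      exact mul_ne_zero h2 h2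
    have hB := card_le_two_mul_card_isSquare_sub_sq h2 hneg hN
    have hA := card_le_two_mul_card_isSquare_sub_sq h2 hneg h4
    set A := Finset.univ.filter fun x : F => IsSquare (4 - x ^ 2)
    set B := Finset.univ.filter fun x : F => IsSquare (N - x ^ 2)
    have hinj : Function.Injective fun s : F => N - 1 - 2 * s := fun x y h =>
      mul_left_cancel₀ h2 (sub_right_injective h)
    have hcard := Finset.card_image_of_injective B hinj
    obtain ⟨y, hy⟩ : ((B.image fun s : F => N - 1 - 2 * s) ∩ A).Nonempty := by
      refine Finset.inter_nonempty_of_card_lt_card_add_card (Finset.subset_univ _)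
        (Finset.subset_univ _) ?_
      rw [Finset.card_univ]
      omega
    obtain ⟨hyB, hyA⟩ := Finset.mem_inter.1 hy
    obtain ⟨s, hs, rfl⟩ := Finset.mem_image.1 hyB
    exact ⟨s, (Finset.mem_filter.1 hs).2, (Finset.mem_filter.1 hyA).2⟩
  obtain ⟨c, hc⟩ : ∃ c, c = (s * a - t * b) / N := ⟨_, rfl⟩
  obtain ⟨d, hd⟩ : ∃ d, d = (s * b + t * a) / N := ⟨_, rfl⟩
  have hcd : c ^ 2 + d ^ 2 = 1 := by
    rw [hc, hd]
    field_simp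
    linear_combination (-(s ^ 2 + t ^ 2)) * hNdef - N * ht
  have hdot : a * c + b * d = s := by
    rw [hc, hd]
    field_simp
    linear_combination (-s) * hNdef
  obtain ⟨M, hM⟩ : ∃ M, M = (a - c) ^ 2 + (b - d) ^ 2 := ⟨_, rfl⟩
  have hMw : M * (4 - M) = w ^ 2 := by
    have : M = N + 1 - 2 * s := by linear_combination hM - hNdef + hcd - 2 * hdot
    rw [this]
    linear_combination hw
  by_cases hM0 : M = 0
  · obtain ⟨h0, h1⟩ := anisotropic _ _ (hM.symm.trans hM0)
    refine ⟨![![c, d], ![1, 0], ![-1, 0]], fun i => ?_, funext fun j => ?_⟩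
    · fin_cases i <;> simp [Fin.sum_univ_two, hcd]
    · fin_cases j <;> simp [Fin.sum_univ_three, ← ha, ← hb]
      · linear_combination h0
      · linear_combination h1
  · obtain ⟨k, hk⟩ : ∃ k, k = w / (2 * M) := ⟨_, rfl⟩
    have hunit : M * ((1 / 2) ^ 2 + k ^ 2) = 1 := by
      rw [hk]
      field_simp
      linear_combination -hMw
    refine ⟨![![c, d], ![(a - c) / 2 - k * (b - d), (b - d) / 2 + k * (a - c)],
      ![(a - c) / 2 + k * (b - d), (b - d) / 2 - k * (a - c)]], fun i => ?_, funext fun j => ?_⟩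
    · fin_cases i <;> simp [Fin.sum_univ_two, hcd] <;>
        linear_combination hunit - ((1 / 2) ^ 2 + k ^ 2) * hM
    · fin_cases j <;> simp [Fin.sum_univ_three, ← ha, ← hb] <;> field_simp <;> ring
end

section
/- Let q = pⁿ be an odd prime power and F the finite field of order q. The zero vector in F² is the sum of three unit vectors if and only if p ≡ 1, 3, or 11 (mod 12) or n is even. (That is: (∃ u₁, u₂, u₃ ∈ F² with ‖uᵢ‖ = 1 and u₁ + u₂ + u₃ = 0) ↔ (p mod 12 ∈ {1, 3, 11} or n is even).) -/
/-- The zero vector of `F²` is a sum of three unit vectors iff `3` is a square in `F`. -/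
theorem exists_three_units_sum_eq_zero_iff_isSquare_three {F : Type*} [Field F]
    (h2 : (2 : F) ≠ 0) :
    (∃ u : Fin 3 → (Fin 2 → F),
      (∀ i, (∑ j, u i j ^ 2) = 1) ∧ (∑ i, u i) = 0) ↔ IsSquare (3 : F) := by
  constructor
  · rintro ⟨u, hu, hs⟩
    have e0 := congrFun hs 0
    have e1 := congrFun hs 1
    have u0 := hu 0
    have u1 := hu 1
    have u2 := hu 2
    simp only [Fin.sum_univ_three, Fin.sum_univ_two, Pi.add_apply, Pi.zero_apply] at e0 e1 u0 u1 u2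
    refine ⟨2 * (u 0 0 * u 1 1 - u 0 1 * u 1 0), ?_⟩
    have hdot : 2 * (u 0 0 * u 1 0 + u 0 1 * u 1 1) = -1 := by
      rw [show u 2 0 = -(u 0 0 + u 1 0) by linear_combination e0,
        show u 2 1 = -(u 0 1 + u 1 1) by linear_combination e1] at u2
      linear_combination u2 - u0 - u1
    linear_combination (-4 * (u 1 0 ^ 2 + u 1 1 ^ 2)) * u0 - 4 * u1 +
      (2 * (u 0 0 * u 1 0 + u 0 1 * u 1 1) - 1) * hdot
  · rintro ⟨s, hs⟩
    refine ⟨![![1, 0], ![-1 / 2, s / 2], ![-1 / 2, -s / 2]], ?_, ?_⟩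
    · intro i
      fin_cases i <;> simp <;> field_simp <;> linear_combination -hs
    · ext j
      fin_cases j <;> simp [Fin.sum_univ_three] <;> field_simp <;> ring

/-- In a finite field of odd cardinality prime to `3`, `3` is a square iff the cardinality
is `±1` modulo `12`. -/
theorem FiniteField.isSquare_three_iff {F : Type*} [Field F] [Fintype F]
    (hF : Odd (Fintype.card F)) (h3 : ¬ 3 ∣ Fintype.card F) :
    IsSquare (3 : F) ↔ Fintype.card F % 12 = 1 ∨ Fintype.card F % 12 = 11 := by
  have hchar : ringChar F ≠ 2 := fun h => by
    have := FiniteField.even_card_of_char_two h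
    have := Nat.odd_iff.mp hF
    omega
  have key := FiniteField.isSquare_odd_prime_iff hchar (p := 3) (by decide)
  rw [show ((3 : ℕ) : F) = 3 by norm_num] at key
  rw [key, ZMod.χ₄_nat_mod_four]
  have hcases : Fintype.card F % 12 = 1 ∨ Fintype.card F % 12 = 5 ∨
      Fintype.card F % 12 = 7 ∨ Fintype.card F % 12 = 11 := by
    have := Nat.odd_iff.mp hF
    omega
  have hmod : ((Fintype.card F : ℕ) : ZMod 3) = ((Fintype.card F % 12 % 3 : ℕ) : ZMod 3) := by
    rw [Nat.mod_mod_of_dvd _ (by norm_num : 3 ∣ 12), ZMod.natCast_mod]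
  rw [hmod, ← Nat.mod_mod_of_dvd (Fintype.card F) (by norm_num : 4 ∣ 12)]
  rcases hcases with h | h | h | h <;> rw [h] <;> decide

/-- For `q = pⁿ` an odd prime power, the zero vector of `F²` is a sum of three unit
vectors iff `p ≡ 1, 3, 11 (mod 12)` or `n` is even. -/
theorem zero_vector_sum_three_units_iff (p n : ℕ) (hp : p.Prime) (hodd : Odd p)
    (hn : 0 < n) (F : Type*) [Field F] [Fintype F] (hq : Fintype.card F = p ^ n) :
    (∃ u : Fin 3 → (Fin 2 → F),
      (∀ i, (∑ j, u i j ^ 2) = 1) ∧ (∑ i, u i) = 0) ↔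
    (p % 12 = 1 ∨ p % 12 = 3 ∨ p % 12 = 11 ∨ Even n) := by
  have : Fact p.Prime := ⟨hp⟩
  have hcard : Odd (Fintype.card F) := hq ▸ hodd.pow
  have h2 : (2 : F) ≠ 0 := Ring.two_ne_zero fun h => by
    have := FiniteField.even_card_of_char_two h
    have := Nat.odd_iff.mp hcard
    omega
  rw [exists_three_units_sum_eq_zero_iff_isSquare_three h2]
  by_cases h3 : 3 ∣ p
  · obtain rfl : 3 = p := (Nat.prime_dvd_prime_iff_eq Nat.prime_three hp).mp h3
    have h0 : (3 : F) = 0 := by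
      have := Nat.cast_card_eq_zero F
      rw [hq] at this
      exact_mod_cast eq_zero_of_pow_eq_zero (by exact_mod_cast this : ((3 : ℕ) : F) ^ n = 0)
    simp [h0]
  · rw [FiniteField.isSquare_three_iff hcard
      (fun h => h3 (Nat.prime_three.dvd_of_dvd_pow (hq ▸ h))), hq]
    have hcases : p % 12 = 1 ∨ p % 12 = 5 ∨ p % 12 = 7 ∨ p % 12 = 11 := by
      have := Nat.odd_iff.mp hodd
      omega
    have hsq : p ^ 2 % 12 = 1 := by
      rcases hcases with h | h | h | h <;> simp [Nat.pow_mod, h]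
    rcases Nat.even_or_odd' n with ⟨k, rfl | rfl⟩
    · have : p ^ (2 * k) % 12 = 1 := by simp [pow_mul, Nat.pow_mod, hsq]
      simp [this]
    · have : p ^ (2 * k + 1) % 12 = p % 12 := by
        rw [pow_succ, pow_mul, Nat.mul_mod, Nat.pow_mod, hsq]
        simp
      have hn_odd : ¬ Even (2 * k + 1) := by simp
      simp only [this, hn_odd, or_false]
      omega
end

section
/- Let q be an odd prime power with q ≡ 3 (mod 4), F the finite field of order q, and a, b ∈ F with a² + b² = −1. Then the vector (a, b, −1) ∈ F³ cannot be written as the sum of two unit vectors, but it can be written as a sum of three unit vectors. -/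
/-- When `q ≡ 3 (mod 4)` and `a² + b² = -1`, the vector `(a, b, -1) ∈ F³` is not a sum
of two unit vectors, but is a sum of three unit vectors. -/
theorem vector_abneg1_not_two_units_but_three (q : ℕ) (F : Type*) [Field F] [Fintype F]
    (hq : Fintype.card F = q) (hodd : Odd q) (hq4 : q % 4 = 3)
    (a b : F) (hab : a ^ 2 + b ^ 2 = -1) :
    (¬ ∃ u w : Fin 3 → F,
      (∑ j, u j ^ 2) = 1 ∧ (∑ j, w j ^ 2) = 1 ∧ ![a, b, -1] = u + w) ∧
    (∃ u : Fin 3 → (Fin 3 → F),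
      (∀ i, (∑ j, u i j ^ 2) = 1) ∧ ![a, b, -1] = ∑ i, u i) := by
  have h2 : (2 : F) ≠ 0 := by
    refine Ring.two_ne_zero fun h => ?_
    have := FiniteField.even_card_of_char_two h
    rw [hq] at this
    omega
  constructor
  · rintro ⟨u, w, hu, hw, h⟩
    have e0 := congrFun h 0
    have e1 := congrFun h 1
    have e2 := congrFun h 2
    simp only [Matrix.cons_val, Pi.add_apply] at e0 e1 e2
    rw [Fin.sum_univ_three] at hu hw
    rw [show w 0 = a - u 0 by linear_combination -e0,
      show w 1 = b - u 1 by linear_combination -e1,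
      show w 2 = -1 - u 2 by linear_combination -e2] at hw
    have horth : u 2 = a * u 0 + b * u 1 :=
      mul_left_cancel₀ h2 (by linear_combination hw - hu - hab)
    rw [horth] at hu
    have hsq : IsSquare (-1 : F) :=
      ⟨b * u 0 - a * u 1, by linear_combination hu - (u 0 ^ 2 + u 1 ^ 2) * hab⟩
    exact FiniteField.isSquare_neg_one_iff.mp hsq (hq ▸ hq4)
  · have h8 : (8 : F) ≠ 0 := by
      rw [show (8 : F) = 2 ^ 3 by norm_num]
      exact pow_ne_zero 3 h2
    refine ⟨![![0, 0, -1], ![(4 * a + b) / 8, (4 * b - a) / 8, 9 / 8],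
      ![(4 * a - b) / 8, (4 * b + a) / 8, -9 / 8]], fun i => ?_, ?_⟩
    · fin_cases i <;> simp only [Fin.sum_univ_three, Matrix.cons_val, Fin.zero_eta, Fin.mk_one,
        Fin.reduceFinMk]
      · ring
      all_goals
        field_simp
        linear_combination 17 * hab
    · ext i
      fin_cases i <;> simp only [Fin.sum_univ_three, Matrix.cons_val, Fin.zero_eta, Fin.mk_one,
        Fin.reduceFinMk, Pi.add_apply]
      all_goals
        field_simp
        ring
end

section
/- Let q be an odd prime power, F the finite field of order q, and d ≥ 4. Then every vector in F^d is the sum of two unit vectors: for every v ∈ F^d there exist u, w ∈ F^d with ‖u‖ = ‖w‖ = 1 and v = u + w. -/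
open Polynomial in
/-- A nondegenerate binary diagonal quadratic form over a finite field of odd order is universal. -/
theorem exists_mul_sq_add_mul_sq_eq {F : Type*} [Field F] [Fintype F]
    (hodd : Odd (Fintype.card F)) {a b : F} (ha : a ≠ 0) (hb : b ≠ 0) (c : F) :
    ∃ x y : F, a * x ^ 2 + b * y ^ 2 = c := by
  have hf : degree (C a * X ^ 2 : F[X]) = 2 := degree_C_mul_X_pow 2 ha
  have hg : degree (C b * X ^ 2 - C c : F[X]) = 2 := by
    rw [degree_sub_C] <;> rw [degree_C_mul_X_pow 2 hb] <;> norm_num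
  obtain ⟨x, y, h⟩ := FiniteField.exists_root_sum_quadratic hf hg (Nat.odd_iff.mp hodd)
  refine ⟨x, y, ?_⟩
  simp only [eval_sub, eval_mul, eval_C, eval_pow, eval_X] at h
  linear_combination h

/-- Over a finite field of odd order, the sum of four squares represents every element on the
orthogonal complement of any vector. -/
theorem exists_orthogonal_sum_four_sq_eq {F : Type*} [Field F] [Fintype F]
    (hodd : Odd (Fintype.card F)) (h2 : (2 : F) ≠ 0) (a b c d r : F) :
    ∃ x y z w : F, a * x + b * y + c * z + d * w = 0 ∧ x ^ 2 + y ^ 2 + z ^ 2 + w ^ 2 = r := by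
  by_cases hN : a ^ 2 + b ^ 2 + c ^ 2 + d ^ 2 = 0
  · by_cases hab : a ^ 2 + b ^ 2 = 0
    · by_cases hac : a ^ 2 + c ^ 2 = 0
      · by_cases had : a ^ 2 + d ^ 2 = 0
        · have ha : a = 0 := by
            have h : 2 * a ^ 2 = 0 := by linear_combination hab + hac + had - hN
            simpa [h2] using h
          have hb : b = 0 := by simpa [ha] using hab
          have hc : c = 0 := by simpa [ha] using hac
          have hd : d = 0 := by simpa [ha] using had
          obtain ⟨x, y, h⟩ :=
            exists_mul_sq_add_mul_sq_eq hodd (one_ne_zero (α := F)) one_ne_zero r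
          exact ⟨x, y, 0, 0, by simp [ha, hb, hc, hd], by linear_combination h⟩
        · have hbc : b ^ 2 + c ^ 2 ≠ 0 := fun h => had (by linear_combination hN - h)
          obtain ⟨x, y, h⟩ := exists_mul_sq_add_mul_sq_eq hodd had hbc r
          exact ⟨d * x, c * y, -b * y, -a * x, by ring, by linear_combination h⟩
      · have hbd : b ^ 2 + d ^ 2 ≠ 0 := fun h => hac (by linear_combination hN - h)
        obtain ⟨x, y, h⟩ := exists_mul_sq_add_mul_sq_eq hodd hac hbd r
        exact ⟨c * x, d * y, -a * x, -b * y, by ring, by linear_combination h⟩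
    · have hcd : c ^ 2 + d ^ 2 ≠ 0 := fun h => hab (by linear_combination hN - h)
      obtain ⟨x, y, h⟩ := exists_mul_sq_add_mul_sq_eq hodd hab hcd r
      exact ⟨b * x, -a * x, d * y, -c * y, by ring, by linear_combination h⟩
  · obtain ⟨x, y, h⟩ := exists_mul_sq_add_mul_sq_eq hodd hN hN r
    exact ⟨-b * x - c * y, a * x + d * y, -d * x + a * y, c * x - b * y, by ring,
      by linear_combination h⟩

/-- For `d ≥ 4`, every vector in `F^d` is the sum of two unit vectors. -/
theorem every_vector_sum_two_units_high_dim (q : ℕ) (F : Type*) [Field F] [Fintype F]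
    (hq : Fintype.card F = q) (hodd : Odd q) (d : ℕ) (hd : 4 ≤ d) (v : Fin d → F) :
    ∃ u w : Fin d → F,
      (∑ j, u j ^ 2) = 1 ∧ (∑ j, w j ^ 2) = 1 ∧ v = u + w := by
  subst hq
  have h2 : (2 : F) ≠ 0 := by
    refine Ring.two_ne_zero fun h => ?_
    have := FiniteField.even_card_of_char_two h
    rw [Nat.odd_iff] at hodd
    omega
  obtain ⟨k, rfl⟩ := Nat.exists_eq_add_of_le hd
  obtain ⟨t, hvt, ht⟩ : ∃ t : Fin (4 + k) → F,
      ∑ j, v j * t j = 0 ∧ ∑ j, t j ^ 2 = 1 - ∑ j, (v j / 2) ^ 2 := by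
    obtain ⟨x, y, z, w, h₀, h₁⟩ := exists_orthogonal_sum_four_sq_eq hodd h2
      (v (Fin.castAdd k 0)) (v (Fin.castAdd k 1)) (v (Fin.castAdd k 2)) (v (Fin.castAdd k 3))
      (1 - ∑ j, (v j / 2) ^ 2)
    refine ⟨Fin.append ![x, y, z, w] 0, ?_, ?_⟩
    · rw [Fin.sum_univ_add]
      simpa [Fin.sum_univ_four] using h₀
    · rw [← h₁, Fin.sum_univ_add]
      simp [Fin.sum_univ_four]
  refine ⟨fun j => v j / 2 + t j, fun j => v j / 2 - t j, ?_, ?_, ?_⟩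
  · have h : ∀ j, (v j / 2 + t j) ^ 2 = (v j / 2) ^ 2 + v j * t j + t j ^ 2 := fun j => by
      field_simp
      ring
    simp only [h, Finset.sum_add_distrib, hvt, ht]
    ring
  · have h : ∀ j, (v j / 2 - t j) ^ 2 = (v j / 2) ^ 2 - v j * t j + t j ^ 2 := fun j => by
      field_simp
      ring
    simp only [h, Finset.sum_add_distrib, Finset.sum_sub_distrib, hvt, ht]
    ring
  · ext j
    simp only [Pi.add_apply]
    field_simp
    ring
end

section
/- Let q be an odd prime power and F the finite field of order q. The index of the orthogonal group O(2;q) = {A ∈ Mat₂(F) : AᵀA = I} in GL₂(F) (equivalently, the number of congruence classes of nondegenerate triangles in the plane F²) equals q(q² − 1)/2 if q ≡ 1 (mod 4) and q(q − 1)²/2 if q ≡ 3 (mod 4). -/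
open Matrix

/-- An orthogonal `2 × 2` matrix is determined by its first column and its determinant. -/
def orthogonalEquivCircleProd (F : Type*) [Field F] :
    {A : Matrix (Fin 2) (Fin 2) F // Aᵀ * A = 1} ≃
      {p : F × F // p.1 ^ 2 + p.2 ^ 2 = 1} × {e : F // e ^ 2 = 1} where
  toFun A := (⟨(A.1 0 0, A.1 1 0), by
      have h := congrFun (congrFun A.2 0) 0
      simp [Matrix.mul_apply, Fin.sum_univ_two] at h
      linear_combination h⟩,
    ⟨A.1.det, by
      have h := congrArg Matrix.det A.2
      rw [det_mul, det_transpose, det_one] at h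
      linear_combination h⟩)
  invFun p := ⟨!![p.1.1.1, -p.2.1 * p.1.1.2; p.1.1.2, p.2.1 * p.1.1.1], by
    obtain ⟨⟨⟨x, y⟩, h⟩, ⟨e, he⟩⟩ := p
    simp only at h he
    ext i j
    fin_cases i <;> fin_cases j <;> simp [Matrix.mul_apply, Fin.sum_univ_two]
    · linear_combination h
    · ring
    · ring
    · linear_combination e ^ 2 * h + he⟩
  left_inv := by
    rintro ⟨A, hA⟩
    have h00 := congrFun (congrFun hA 0) 0
    have h01 := congrFun (congrFun hA 0) 1
    simp [Matrix.mul_apply, Fin.sum_univ_two] at h00 h01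
    ext i j
    fin_cases i <;> fin_cases j <;> simp [det_fin_two]
    · linear_combination A 0 1 * h00 - A 0 0 * h01
    · linear_combination A 1 1 * h00 - A 1 0 * h01
  right_inv := by
    rintro ⟨⟨⟨x, y⟩, h⟩, ⟨e, he⟩⟩
    simp only at h
    simp [det_fin_two]
    linear_combination e * h

/-- A square root `i` of `-1` identifies the circle with the unit group via `(x, y) ↦ x + i y`. -/
def circleEquivUnits {F : Type*} [Field F] (h2 : (2 : F) ≠ 0) {i : F} (hi : i ^ 2 = -1) :
    {p : F × F // p.1 ^ 2 + p.2 ^ 2 = 1} ≃ Fˣ where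
  toFun p := ⟨p.1.1 + i * p.1.2, p.1.1 - i * p.1.2,
    by linear_combination p.2 - p.1.2 ^ 2 * hi, by linear_combination p.2 - p.1.2 ^ 2 * hi⟩
  invFun u := ⟨((u + ↑u⁻¹) / 2, i * (↑u⁻¹ - u) / 2), by
    have hu : (u : F) * ↑u⁻¹ = 1 := u.mul_inv
    field_simp
    linear_combination 4 * hu + (↑u⁻¹ - (u : F)) ^ 2 * hi⟩
  left_inv := by
    rintro ⟨⟨x, y⟩, h⟩
    simp only [Subtype.mk.injEq, Prod.mk.injEq, Units.inv_mk]
    constructor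
    · field_simp
      ring
    · field_simp
      linear_combination -2 * y * hi
  right_inv u := by
    ext
    simp only
    field_simp
    linear_combination (↑u⁻¹ - (u : F)) * hi

/-- If `-1` is not a square, stereographic projection from `(-1, 0)` identifies the circle with
the projective line. -/
noncomputable def circleEquivOption {F : Type*} [Field F] (h2 : (2 : F) ≠ 0)
    (hi : ∀ t : F, 1 + t ^ 2 ≠ 0) :
    Option F ≃ {p : F × F // p.1 ^ 2 + p.2 ^ 2 = 1} :=
  Equiv.ofBijective
    (fun
      | none => ⟨(-1, 0), by simp⟩
      | some t => ⟨((1 - t ^ 2) / (1 + t ^ 2), 2 * t / (1 + t ^ 2)), by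
          have := hi t
          field_simp
          ring⟩) <| by
    constructor
    · rintro (_ | s) (_ | t) h
      · rfl
      · have := hi t
        simp only [Subtype.mk.injEq, Prod.mk.injEq] at h
        have h1 := h.1
        field_simp at h1
        exact absurd (by linear_combination -h1) h2
      · have := hi s
        simp only [Subtype.mk.injEq, Prod.mk.injEq] at h
        have h1 := h.1
        field_simp at h1
        exact absurd (by linear_combination h1) h2
      · have hs := hi s
        have ht := hi t
        simp only [Subtype.mk.injEq, Prod.mk.injEq] at h
        obtain ⟨h1, h3⟩ := h
        rw [div_eq_div_iff hs ht] at h1 h3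
        have hst : 2 * (s ^ 2 - t ^ 2) = 0 := by linear_combination -h1
        have hst : s ^ 2 - t ^ 2 = 0 := (mul_eq_zero.mp hst).resolve_left h2
        have : 2 * ((1 + t ^ 2) * (s - t)) = 0 := by linear_combination h3 + 2 * t * hst
        have := (mul_eq_zero.mp ((mul_eq_zero.mp this).resolve_left h2)).resolve_left ht
        rw [sub_eq_zero.mp this]
    · rintro ⟨⟨x, y⟩, h⟩
      simp only at h
      by_cases hx : 1 + x = 0
      · obtain rfl : x = -1 := by linear_combination hx
        obtain rfl : y = 0 := by
          have : y ^ 2 = 0 := by linear_combination h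
          simpa using this
        exact ⟨none, rfl⟩
      · have hy : 1 + (y / (1 + x)) ^ 2 = 2 / (1 + x) := by
          field_simp
          linear_combination h
        refine ⟨some (y / (1 + x)), ?_⟩
        simp only [Subtype.mk.injEq, Prod.mk.injEq, hy]
        constructor
        · field_simp
          linear_combination -h
        · field_simp

theorem card_sq_eq_one {F : Type*} [Field F] (h2 : (2 : F) ≠ 0) :
    Nat.card {e : F // e ^ 2 = 1} = 2 := by
  have hne : (1 : F) ≠ -1 := fun h => h2 (by linear_combination h)
  have hset : {e : F | e ^ 2 = 1} = {1, -1} := by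
    ext e
    simp
  exact (Nat.card_coe_set_eq {e : F | e ^ 2 = 1}).trans (hset ▸ Set.ncard_pair hne)

theorem card_GL_fin_two (F : Type*) [Field F] [Fintype F] :
    Nat.card (GL (Fin 2) F) =
      (Fintype.card F ^ 2 - 1) * (Fintype.card F ^ 2 - Fintype.card F) := by
  simp [card_GL_field, Fin.prod_univ_two]

/-- The index of the orthogonal group `O(2;q)` in `GL₂(F)` equals `q(q²-1)/2` when
`q ≡ 1 (mod 4)` and `q(q-1)²/2` when `q ≡ 3 (mod 4)`. -/
theorem index_of_orthogonal_in_GL2 (q : ℕ) (F : Type*) [Field F] [Fintype F]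
    (hq : Fintype.card F = q) (hodd : Odd q) :
    (q % 4 = 1 →
      Nat.card (GL (Fin 2) F) /
        Nat.card {A : Matrix (Fin 2) (Fin 2) F // Aᵀ * A = 1} = q * (q ^ 2 - 1) / 2) ∧
    (q % 4 = 3 →
      Nat.card (GL (Fin 2) F) /
        Nat.card {A : Matrix (Fin 2) (Fin 2) F // Aᵀ * A = 1} = q * (q - 1) ^ 2 / 2) := by
  have h2 : (2 : F) ≠ 0 := by
    refine Ring.two_ne_zero fun hF => ?_
    have := FiniteField.even_card_of_char_two hF
    rw [hq] at this
    rcases hodd with ⟨k, rfl⟩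
    omega
  obtain ⟨r, rfl⟩ : ∃ r, q = r + 1 := Nat.exists_eq_succ_of_ne_zero hodd.pos.ne'
  have hsq : (r + 1) ^ 2 - 1 = r * (r + 2) := Nat.sub_eq_of_eq_add (by ring)
  have hmul : (r + 1) ^ 2 - (r + 1) = r * (r + 1) := Nat.sub_eq_of_eq_add (by ring)
  rw [card_GL_fin_two, hq, hsq, hmul, Nat.card_congr (orthogonalEquivCircleProd F), Nat.card_prod,
    card_sq_eq_one h2, Nat.add_sub_cancel]
  refine ⟨fun h => ?_, fun h => ?_⟩
  · obtain ⟨i, hi⟩ := FiniteField.isSquare_neg_one_iff.mpr (by omega : Fintype.card F % 4 ≠ 3)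
    have hr : 0 < r := by
      have := Fintype.one_lt_card (α := F)
      omega
    rw [Nat.card_congr (circleEquivUnits h2 (by rw [hi, sq] : i ^ 2 = -1)), Nat.card_units,
      Nat.card_eq_fintype_card, hq, Nat.add_sub_cancel, ← Nat.mul_div_mul_left _ 2 hr]
    congr 1
    ring
  · have hi (t : F) : 1 + t ^ 2 ≠ 0 := fun ht =>
      FiniteField.isSquare_neg_one_iff.mp ⟨t, by linear_combination -ht⟩ (hq ▸ h)
    rw [← Nat.card_congr (circleEquivOption h2 hi), Nat.card_eq_fintype_card, Fintype.card_option,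
      hq, ← Nat.mul_div_mul_left _ 2 (Nat.succ_pos (r + 1))]
    congr 1
    simp only [Nat.succ_eq_add_one]
    ring
end

section
/- Let q be an odd prime power, F the finite field of order q, and v ∈ F² a nonzero vector with ‖v‖ = L. Then v is a sum of two unit vectors if and only if L ≠ 0 and 4L − L² is a square in F (possibly zero). -/
/-- A nonzero vector of length `L` in `F²` is a sum of two unit vectors iff `L ≠ 0`
and `4L - L²` is a square in `F`. -/
theorem sum_two_units_iff_square (q : ℕ) (F : Type*) [Field F] [Fintype F]
    (hq : Fintype.card F = q) (hodd : Odd q)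
    (v : Fin 2 → F) (hv : v ≠ 0) (L : F) (hL : (∑ i, v i ^ 2) = L) :
    (∃ u w : Fin 2 → F,
      (∑ i, u i ^ 2) = 1 ∧ (∑ i, w i ^ 2) = 1 ∧ v = u + w) ↔
    (L ≠ 0 ∧ IsSquare (4 * L - L ^ 2)) := by
  have h2 : (2 : F) ≠ 0 := Ring.two_ne_zero fun h => by
    have := FiniteField.even_card_of_char_two h
    rw [hq] at this
    exact Nat.not_even_iff_odd.mpr hodd (Nat.even_iff.mpr this)
  simp only [Fin.sum_univ_two] at hL ⊢
  constructor
  · rintro ⟨u, w, hu, hw, rfl⟩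
    simp only [Pi.add_apply] at hL
    -- the dot product of `u` and `w` is `L / 2 - 1`
    have ht : L = 2 * (1 + (u 0 * w 0 + u 1 * w 1)) := by linear_combination hu + hw - hL
    -- Lagrange's identity
    have hx : (u 0 * w 1 - u 1 * w 0) ^ 2 = 1 - (u 0 * w 0 + u 1 * w 1) ^ 2 := by
      linear_combination (w 0 ^ 2 + w 1 ^ 2) * hu + hw
    refine ⟨fun h0 => hv ?_, 2 * (u 0 * w 1 - u 1 * w 0), ?_⟩
    · have hd : u 0 * w 0 + u 1 * w 1 = -1 := by
        have := (mul_eq_zero.mp (ht.symm.trans h0)).resolve_left h2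
        linear_combination this
      have hc : u 0 * w 1 - u 1 * w 0 = 0 := by
        rw [hd] at hx
        exact pow_eq_zero_iff two_ne_zero |>.mp (by linear_combination hx)
      ext i
      fin_cases i
      · change u 0 + w 0 = 0
        linear_combination u 0 * hd - u 1 * hc - w 0 * hu
      · change u 1 + w 1 = 0
        linear_combination u 1 * hd + u 0 * hc - w 1 * hu
    · rw [ht]
      linear_combination -4 * hx
  · rintro ⟨h0, s, hs⟩
    have hk : (v 0 / 2) ^ 2 + (v 1 / 2) ^ 2
        + (s / (2 * L)) ^ 2 * (v 0 ^ 2 + v 1 ^ 2) = 1 := by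
      rw [div_pow, div_pow, ← add_div, hL]
      field_simp
      linear_combination -hs
    refine ⟨![v 0 / 2 - s / (2 * L) * v 1, v 1 / 2 + s / (2 * L) * v 0],
      ![v 0 / 2 + s / (2 * L) * v 1, v 1 / 2 - s / (2 * L) * v 0], ?_, ?_, ?_⟩
    · simp only [Matrix.cons_val_zero, Matrix.cons_val_one]
      linear_combination hk
    · simp only [Matrix.cons_val_zero, Matrix.cons_val_one]
      linear_combination hk
    · ext i
      fin_cases i <;> simp <;> field_simp <;> ring
end

section
/- Let q be an odd prime power, F the finite field of order q, and (a, c) ∈ F² with L₁ := a² + c² ≠ 0. For given L₂, μ ∈ F, the number of vectors (b, d) ∈ F² with b² + d² = L₂ and ab + cd = μ equals: 2 if L₁L₂ − μ² is a nonzero square in F; 1 if L₁L₂ − μ² = 0; and 0 if L₁L₂ − μ² is not a square in F. -/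
/-- Sending `(b, d)` to the determinant `ad - cb` identifies the solutions of `b² + d² = L₂`,
`ab + cd = μ` with the square roots of `(a² + c²)L₂ - μ²`. -/
def secondColumnEquiv {F : Type*} [Field F] (a c : F) (hL : a ^ 2 + c ^ 2 ≠ 0) (L₂ μ : F) :
    {p : F × F // p.1 ^ 2 + p.2 ^ 2 = L₂ ∧ a * p.1 + c * p.2 = μ} ≃
      {x : F // x ^ 2 = (a ^ 2 + c ^ 2) * L₂ - μ ^ 2} where
  toFun p := ⟨a * p.1.2 - c * p.1.1, by
    linear_combination (a ^ 2 + c ^ 2) * p.2.1 - (a * p.1.1 + c * p.1.2 + μ) * p.2.2⟩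
  invFun x := ⟨((a * μ - c * x) / (a ^ 2 + c ^ 2), (c * μ + a * x) / (a ^ 2 + c ^ 2)), by
    obtain ⟨x, hx⟩ := x
    constructor
    · field_simp
      linear_combination (a ^ 2 + c ^ 2) * hx
    · field_simp
      ring⟩
  left_inv := by
    rintro ⟨⟨b, d⟩, h₁, h₂⟩
    simp only [Subtype.mk.injEq, Prod.mk.injEq] at h₂ ⊢
    constructor
    · field_simp
      linear_combination -a * h₂
    · field_simp
      linear_combination -c * h₂
  right_inv := by
    rintro ⟨x, hx⟩
    simp only [Subtype.mk.injEq]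
    field_simp
    ring

theorem card_sqrt_of_isSquare {F : Type*} [Field F] (h2 : (2 : F) ≠ 0) {D : F} (hD : D ≠ 0)
    (h : IsSquare D) : Nat.card {x : F // x ^ 2 = D} = 2 := by
  obtain ⟨r, rfl⟩ := h
  have hr : r ≠ 0 := by
    rintro rfl
    simp at hD
  have hne : r ≠ -r := by
    intro h
    exact mul_ne_zero h2 hr (by linear_combination h)
  have hset : {x : F | x ^ 2 = r * r} = {r, -r} := by
    ext x
    simp [← sq, sq_eq_sq_iff_eq_or_eq_neg]
  have hcard : Set.ncard {x : F | x ^ 2 = r * r} = 2 := by rw [hset, Set.ncard_pair hne]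
  exact hcard

/-- Counting vectors `(b,d)` with `b² + d² = L₂` and `ab + cd = μ`, given
`L₁ = a² + c² ≠ 0`: there are 2 when `L₁L₂ - μ²` is a nonzero square, 1 when it is
zero, and 0 when it is a nonsquare. -/
theorem count_second_column (q : ℕ) (F : Type*) [Field F] [Fintype F]
    (hq : Fintype.card F = q) (hodd : Odd q)
    (a c : F) (hL1 : a ^ 2 + c ^ 2 ≠ 0) (L₂ μ : F) :
    ((a ^ 2 + c ^ 2) * L₂ - μ ^ 2 ≠ 0 → IsSquare ((a ^ 2 + c ^ 2) * L₂ - μ ^ 2) →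
      Nat.card {p : F × F // p.1 ^ 2 + p.2 ^ 2 = L₂ ∧ a * p.1 + c * p.2 = μ} = 2) ∧
    ((a ^ 2 + c ^ 2) * L₂ - μ ^ 2 = 0 →
      Nat.card {p : F × F // p.1 ^ 2 + p.2 ^ 2 = L₂ ∧ a * p.1 + c * p.2 = μ} = 1) ∧
    (¬ IsSquare ((a ^ 2 + c ^ 2) * L₂ - μ ^ 2) →
      Nat.card {p : F × F // p.1 ^ 2 + p.2 ^ 2 = L₂ ∧ a * p.1 + c * p.2 = μ} = 0) := by
  rw [Nat.card_congr (secondColumnEquiv a c hL1 L₂ μ)]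
  have h2 : (2 : F) ≠ 0 := by
    refine Ring.two_ne_zero fun h => ?_
    have := FiniteField.even_card_of_char_two h
    rw [hq, ← Nat.even_iff] at this
    exact Nat.not_even_iff_odd.mpr hodd this
  refine ⟨card_sqrt_of_isSquare h2, fun h => ?_, fun h => ?_⟩
  · simp [h]
  · have : IsEmpty {x : F // x ^ 2 = (a ^ 2 + c ^ 2) * L₂ - μ ^ 2} :=
      ⟨fun x => h ⟨x, x.2.symm.trans (sq _)⟩⟩
    exact Nat.card_of_isEmpty
end

section
/- Let q be an odd prime power, F the finite field of order q, and (a, c) ∈ F² a nonzero vector with a² + c² = 0. Given L₂, μ ∈ F: if μ ≠ 0, there is exactly one vector (b, d) ∈ F² with b² + d² = L₂ and ab + cd = μ; if μ = 0 and L₂ = 0, there are exactly q such vectors; and if μ = 0 and L₂ ≠ 0, there is no such vector. -/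
/-- When `(a, c)` is isotropic with `a ≠ 0`, the linear condition `a b + c d = μ` determines `b`
from `d`, and the quadratic condition `b² + d² = L` becomes affine in `d`. -/
def isotropicSolutionsEquiv {F : Type*} [Field F] {a c : F} (ha : a ≠ 0)
    (h : a ^ 2 + c ^ 2 = 0) (L μ : F) :
    {p : F × F // p.1 ^ 2 + p.2 ^ 2 = L ∧ a * p.1 + c * p.2 = μ} ≃
      {d : F // 2 * μ * c * d = μ ^ 2 - a ^ 2 * L} where
  toFun p := ⟨p.1.2, by
    obtain ⟨⟨b, d⟩, h₁, h₂⟩ := p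
    dsimp only at h₁ h₂ ⊢
    subst h₁ h₂
    linear_combination d ^ 2 * h⟩
  invFun d := ⟨((μ - c * d.1) / a, d.1), by
    obtain ⟨d, hd⟩ := d
    dsimp only
    constructor
    · field_simp
      linear_combination d ^ 2 * h - hd
    · field_simp
      ring⟩
  left_inv := by
    rintro ⟨⟨b, d⟩, h₁, h₂⟩
    dsimp only at h₂
    have hb : (μ - c * d) / a = b := by
      rw [div_eq_iff ha]
      linear_combination -h₂
    simp [hb]
  right_inv _ := rfl

/-- Counting vectors `(b,d)` with `b² + d² = L₂` and `ab + cd = μ`, given a nonzero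
vector `(a,c)` of zero length: exactly one when `μ ≠ 0`; exactly `q` when
`μ = 0` and `L₂ = 0`; none when `μ = 0` and `L₂ ≠ 0`. -/
theorem count_second_column_isotropic (q : ℕ) (F : Type*) [Field F] [Fintype F]
    (hq : Fintype.card F = q) (hodd : Odd q)
    (a c : F) (hac : (a, c) ≠ (0, 0)) (hL1 : a ^ 2 + c ^ 2 = 0) (L₂ μ : F) :
    (μ ≠ 0 →
      Nat.card {p : F × F // p.1 ^ 2 + p.2 ^ 2 = L₂ ∧ a * p.1 + c * p.2 = μ} = 1) ∧
    (μ = 0 → L₂ = 0 →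
      Nat.card {p : F × F // p.1 ^ 2 + p.2 ^ 2 = L₂ ∧ a * p.1 + c * p.2 = μ} = q) ∧
    (μ = 0 → L₂ ≠ 0 →
      Nat.card {p : F × F // p.1 ^ 2 + p.2 ^ 2 = L₂ ∧ a * p.1 + c * p.2 = μ} = 0) := by
  have ha : a ≠ 0 := by
    rintro rfl
    simp_all
  have hc : c ≠ 0 := by
    rintro rfl
    simp_all
  have h2 : (2 : F) ≠ 0 := by
    refine Ring.two_ne_zero fun hchar => ?_
    have := FiniteField.even_card_of_char_two hchar
    rw [hq] at this
    obtain ⟨k, rfl⟩ := hodd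
    omega
  rw [Nat.card_congr (isotropicSolutionsEquiv ha hL1 L₂ μ)]
  refine ⟨fun hμ => ?_, ?_, ?_⟩
  · have hk : 2 * μ * c ≠ 0 := mul_ne_zero (mul_ne_zero h2 hμ) hc
    rw [Nat.card_eq_one_iff_exists]
    refine ⟨⟨(μ ^ 2 - a ^ 2 * L₂) / (2 * μ * c), mul_div_cancel₀ _ hk⟩, ?_⟩
    rintro ⟨d, hd⟩
    exact Subtype.ext ((eq_div_iff hk).2 (by rw [mul_comm, hd]))
  · rintro rfl rfl
    simp [hq]
  · rintro rfl hL
    simp [ha, hL]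
end

section
/- Let q be an odd prime power, F the finite field of order q, and L₁, L₂, L₃ ∈ F. There exists a nondegenerate triangle in F² with side lengths L₁, L₂, L₃ (i.e. linearly independent vectors x, y ∈ F² with ‖x‖ = L₁, ‖y‖ = L₂, ‖x − y‖ = L₃) if and only if 2σ₂ − P₂ is a nonzero square in F, where P₂ = L₁² + L₂² + L₃² and σ₂ = L₁L₂ + L₁L₃ + L₂L₃. -/
theorem linearIndependent_pair_fin_two_iff {F : Type*} [Field F] (x y : Fin 2 → F) :
    LinearIndependent F ![x, y] ↔ x 0 * y 1 - x 1 * y 0 ≠ 0 := by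
  have h := Matrix.linearIndependent_rows_iff_isUnit (A := Matrix.of ![x, y])
  rw [Matrix.isUnit_iff_isUnit_det, Matrix.det_fin_two, isUnit_iff_ne_zero] at h
  exact h

theorem FiniteField.exists_sq_add_sq_eq {F : Type*} [Field F] [Fintype F]
    (hF : Fintype.card F % 2 = 1) (c : F) : ∃ a b : F, a ^ 2 + b ^ 2 = c := by
  obtain ⟨a, b, h⟩ := FiniteField.exists_root_sum_quadratic
    (f := Polynomial.X ^ 2) (g := Polynomial.X ^ 2 - Polynomial.C c)
    (Polynomial.degree_X_pow 2) (Polynomial.degree_X_pow_sub_C two_pos c) hF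
  refine ⟨a, b, ?_⟩
  simp only [Polynomial.eval_sub, Polynomial.eval_pow, Polynomial.eval_X,
    Polynomial.eval_C] at h
  linear_combination h

/-- Two vectors of the plane over a finite field of odd order with prescribed norms,
dot product and nonzero determinant exist as soon as Lagrange's identity permits it. -/
theorem FiniteField.exists_pair_of_norm_mul_norm_eq {F : Type*} [Field F] [Fintype F]
    (hF : Fintype.card F % 2 = 1) (h2 : (2 : F) ≠ 0) {L₁ L₂ d e : F} (he : e ≠ 0)
    (h : L₁ * L₂ = d ^ 2 + e ^ 2) :
    ∃ a b c k : F, a ^ 2 + b ^ 2 = L₁ ∧ c ^ 2 + k ^ 2 = L₂ ∧ a * c + b * k = d ∧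
      a * k - b * c = e := by
  by_cases hL : L₁ = 0
  · subst hL
    have hd : d ≠ 0 := by
      rintro rfl
      exact he (by simpa using h.symm)
    refine ⟨1, d / e, (d + L₂ / d) / 2, (d - L₂ / d) * e / (2 * d), ?_, ?_, ?_, ?_⟩
    · field_simp
      linear_combination -h
    · field_simp
      linear_combination -(d ^ 2 - L₂) ^ 2 * h
    · field_simp
      ring
    · field_simp
      linear_combination (d ^ 2 + L₂) * h
  · obtain ⟨a, b, hab⟩ := FiniteField.exists_sq_add_sq_eq hF L₁
    refine ⟨a, b, (d * a - e * b) / L₁, (d * b + e * a) / L₁, hab, ?_, ?_, ?_⟩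
    · field_simp
      linear_combination (d ^ 2 + e ^ 2) * hab - L₁ * h
    · field_simp
      linear_combination d * hab
    · field_simp
      linear_combination e * hab


/-- A nondegenerate triangle with side lengths `L₁, L₂, L₃` exists in `F²` iff
`2σ₂ - P₂` is a nonzero square, where `P₂ = L₁² + L₂² + L₃²` and
`σ₂ = L₁L₂ + L₁L₃ + L₂L₃`. -/
theorem nondegenerate_triangle_exists_iff (q : ℕ) (F : Type*) [Field F] [Fintype F]
    (hq : Fintype.card F = q) (hodd : Odd q) (L₁ L₂ L₃ : F) :
    (∃ x y : Fin 2 → F, LinearIndependent F ![x, y] ∧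
      (∑ i, x i ^ 2) = L₁ ∧ (∑ i, y i ^ 2) = L₂ ∧ (∑ i, (x i - y i) ^ 2) = L₃) ↔
    (2 * (L₁ * L₂ + L₁ * L₃ + L₂ * L₃) - (L₁ ^ 2 + L₂ ^ 2 + L₃ ^ 2) ≠ 0 ∧
     IsSquare (2 * (L₁ * L₂ + L₁ * L₃ + L₂ * L₃) - (L₁ ^ 2 + L₂ ^ 2 + L₃ ^ 2))) := by
  simp only [linearIndependent_pair_fin_two_iff, Fin.sum_univ_two]
  have hF : Fintype.card F % 2 = 1 := by rw [hq]; exact Nat.odd_iff.mp hodd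
  have h2 : (2 : F) ≠ 0 := Ring.two_ne_zero fun hc ↦ by
    have := FiniteField.even_card_of_char_two hc
    omega
  constructor
  · rintro ⟨x, y, hxy, rfl, rfl, rfl⟩
    have key : 2 * ((x 0 ^ 2 + x 1 ^ 2) * (y 0 ^ 2 + y 1 ^ 2) +
        (x 0 ^ 2 + x 1 ^ 2) * ((x 0 - y 0) ^ 2 + (x 1 - y 1) ^ 2) +
        (y 0 ^ 2 + y 1 ^ 2) * ((x 0 - y 0) ^ 2 + (x 1 - y 1) ^ 2)) -
        ((x 0 ^ 2 + x 1 ^ 2) ^ 2 + (y 0 ^ 2 + y 1 ^ 2) ^ 2 +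
          ((x 0 - y 0) ^ 2 + (x 1 - y 1) ^ 2) ^ 2) =
        (2 * (x 0 * y 1 - x 1 * y 0)) ^ 2 := by ring
    rw [key]
    exact ⟨pow_ne_zero 2 (mul_ne_zero h2 hxy), IsSquare.sq _⟩
  · rintro ⟨hne, s, hs⟩
    have hs0 : s ≠ 0 := by
      rintro rfl
      exact hne (by simpa using hs)
    obtain ⟨a, b, c, k, hL₁, hL₂, hd, he⟩ :=
      FiniteField.exists_pair_of_norm_mul_norm_eq hF h2 (L₁ := L₁) (L₂ := L₂)
        (d := (L₁ + L₂ - L₃) / 2) (e := s / 2) (div_ne_zero hs0 h2) (by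
          field_simp
          linear_combination hs)
    refine ⟨![a, b], ![c, k], ?_, hL₁, hL₂, ?_⟩
    · simpa [he] using ⟨hs0, h2⟩
    · have hd' : 2 * (a * c + b * k) = L₁ + L₂ - L₃ := by
        rw [hd]
        field_simp
      simp only [Matrix.cons_val_zero, Matrix.cons_val_one]
      linear_combination hL₁ + hL₂ - hd'
end
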